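/- arXiv:2305.11234 — 6 statements merged into one kernel-verified Lean document; each statement's English description precedes it below -/
import Mathlib

section
/- Let n = 2 and suppose f is a transcendental entire function of finite order on ℂ solving the differential-difference equation f(z)^n + w·f(z)^{n-1}·f'(z) + q(z)e^{Q(z)}·f(z+c) = p₁e^{α₁z} + p₂e^{α₂z}, and suppose λ(f) < ρ(f). Then ρ(f) = deg Q = 1. -/
open MeasureTheory Filter Metric

noncomputable section

/-- The positive part `log⁺` of the logarithm. -/
def logPlus (x : ℝ) : ℝ := max (Real.log x) 0

/-- The Nevanlinna proximity function `m(r,f)`.  For an entire function `f` (which has no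
poles) this coincides with the Nevanlinna characteristic `T(r,f)`. -/
def nevCharEntire (f : ℂ → ℂ) (r : ℝ) : ℝ :=
  (2 * Real.pi)⁻¹ * ∫ θ in (0:ℝ)..(2 * Real.pi), logPlus ‖f (r * Complex.exp (θ * Complex.I))‖

/-- The order of growth `ρ(f) = limsup_{r→∞} log⁺ T(r,f) / log r` of an entire function,
as an extended real number. -/
def growthOrderEntire (f : ℂ → ℂ) : EReal :=
  Filter.limsup (fun r : ℝ => ((logPlus (nevCharEntire f r) / Real.log r : ℝ) : EReal))
    Filter.atTop

/-- An entire function is transcendental if it is not a polynomial. -/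
def TranscendentalEntire (f : ℂ → ℂ) : Prop := ¬ ∃ p : Polynomial ℂ, ∀ z, f z = p.eval z

/-- The multiplicity of `z` as a zero of an entire function `f`: the smallest `k` such that
the `k`-th derivative of `f` does not vanish at `z` (`0` if `f z ≠ 0`). -/
def zeroMult (f : ℂ → ℂ) (z : ℂ) : ℕ := sInf {k : ℕ | iteratedDeriv k f z ≠ 0}

/-- The unintegrated counting function `n(r, 1/f)`: the number of zeros of `f`, counted with
multiplicity, in the closed disc `|z| ≤ r`. -/
def zeroCount (f : ℂ → ℂ) (r : ℝ) : ℕ := ∑ᶠ z ∈ Metric.closedBall (0:ℂ) r, zeroMult f z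

/-- The exponent of convergence of the zeros of `f`:
`λ(f) = limsup_{r→∞} log⁺ n(r,1/f) / log r`, as an extended real number. -/
def zeroExponent (f : ℂ → ℂ) : EReal :=
  Filter.limsup (fun r : ℝ => ((logPlus (zeroCount f r) / Real.log r : ℝ) : EReal))
    Filter.atTop

/-- `h` has growth at most `exp (O(|z|^s))`. -/
def ExpGrowth (s : ℝ) (h : ℂ → ℂ) : Prop :=
  ∃ C : ℝ, 0 ≤ C ∧ ∀ z, ‖h z‖ ≤ Real.exp (C * (1 + ‖z‖) ^ s)

namespace ExpGrowth

variable {s : ℝ} {g h : ℂ → ℂ}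

lemma mono {t : ℝ} (hst : s ≤ t) (hh : ExpGrowth s h) : ExpGrowth t h := by
  obtain ⟨C, hC, H⟩ := hh
  refine ⟨C, hC, fun z => (H z).trans ?_⟩
  gcongr
  linarith [norm_nonneg z]

lemma mul (hg : ExpGrowth s g) (hh : ExpGrowth s h) : ExpGrowth s (fun z => g z * h z) := by
  obtain ⟨C, hC, H⟩ := hg
  obtain ⟨D, hD, K⟩ := hh
  refine ⟨C + D, by positivity, fun z => ?_⟩
  rw [norm_mul, add_mul, Real.exp_add]
  gcongr
  exacts [H z, K z]

lemma one_le_rpow (hs : 0 ≤ s) (z : ℂ) : 1 ≤ (1 + ‖z‖) ^ s :=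
  Real.one_le_rpow (by linarith [norm_nonneg z]) hs

lemma add (hs : 0 ≤ s) (hg : ExpGrowth s g) (hh : ExpGrowth s h) :
    ExpGrowth s (fun z => g z + h z) := by
  obtain ⟨C, hC, H⟩ := hg
  obtain ⟨D, hD, K⟩ := hh
  refine ⟨C + D + 1, by positivity, fun z => ?_⟩
  have h1 := one_le_rpow hs z
  set x := (1 + ‖z‖) ^ s
  have e1 : Real.exp (C * x) ≤ Real.exp (C * x + D * x) := Real.exp_le_exp.2 (by nlinarith)
  have e2 : Real.exp (D * x) ≤ Real.exp (C * x + D * x) := Real.exp_le_exp.2 (by nlinarith)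
  have e3 : 2 ≤ Real.exp x := by linarith [Real.add_one_le_exp x]
  calc ‖g z + h z‖ ≤ ‖g z‖ + ‖h z‖ := norm_add_le _ _
    _ ≤ Real.exp (C * x) + Real.exp (D * x) := add_le_add (H z) (K z)
    _ ≤ Real.exp (C * x + D * x) * 2 := by linarith
    _ ≤ Real.exp (C * x + D * x) * Real.exp x := by gcongr
    _ = Real.exp ((C + D + 1) * x) := by rw [← Real.exp_add]; ring_nf

lemma const (hs : 0 ≤ s) (c : ℂ) : ExpGrowth s (fun _ => c) := by
  refine ⟨‖c‖, norm_nonneg _, fun z => ?_⟩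
  have h1 := one_le_rpow hs z
  have := Real.add_one_le_exp (‖c‖ * (1 + ‖z‖) ^ s)
  nlinarith [norm_nonneg c]

lemma id (hs : 0 < s) : ExpGrowth s (fun z => z) := by
  refine ⟨1 / s, by positivity, fun z => ?_⟩
  have h0 : 0 < 1 + ‖z‖ := by positivity
  calc ‖z‖ ≤ 1 + ‖z‖ := by linarith
    _ = Real.exp (Real.log (1 + ‖z‖)) := (Real.exp_log h0).symm
    _ ≤ _ := by
      gcongr
      have := Real.log_le_rpow_div h0.le hs
      rw [one_div, inv_mul_eq_div]; exact this

lemma pow (hs : 0 ≤ s) (hg : ExpGrowth s g) (n : ℕ) : ExpGrowth s (fun z => g z ^ n) := by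
  induction n with
  | zero => simpa using const hs 1
  | succ n ih => simpa only [pow_succ] using ih.mul hg

lemma polynomial (hs : 0 < s) (p : Polynomial ℂ) : ExpGrowth s (fun z => p.eval z) := by
  induction p using Polynomial.induction_on' with
  | add p q hp hq => simpa only [Polynomial.eval_add] using hp.add hs.le hq
  | monomial n a =>
    simpa only [Polynomial.eval_monomial] using (const hs.le a).mul ((id hs).pow hs.le n)

lemma comp_add (hs : 0 ≤ s) (hg : ExpGrowth s g) (c : ℂ) : ExpGrowth s (fun z => g (z + c)) := by
  obtain ⟨C, hC, H⟩ := hg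
  refine ⟨C * (1 + ‖c‖) ^ s, by positivity, fun z => (H _).trans ?_⟩
  rw [mul_assoc, ← Real.mul_rpow (by positivity) (by positivity)]
  gcongr
  nlinarith [norm_add_le z c, norm_nonneg z, norm_nonneg c]

lemma deriv (hs : 0 ≤ s) (hd : Differentiable ℂ g) (hg : ExpGrowth s g) :
    ExpGrowth s (deriv g) := by
  obtain ⟨C, hC, H⟩ := hg
  refine ⟨C * 2 ^ s, by positivity, fun z => ?_⟩
  have := Complex.norm_deriv_le_of_forall_mem_sphere_norm_le (c := z) (R := 1)
    (C := Real.exp (C * 2 ^ s * (1 + ‖z‖) ^ s)) one_pos hd.diffContOnCl ?_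
  · simpa using this
  · intro w hw
    refine (H w).trans ?_
    rw [mul_assoc, ← Real.mul_rpow (by positivity) (by positivity)]
    gcongr
    have h1 : ‖w - z‖ = 1 := by simpa [dist_eq_norm] using hw
    have h2 : ‖w‖ ≤ ‖z‖ + ‖w - z‖ := by simpa using norm_add_le z (w - z)
    linarith [norm_nonneg z]

end ExpGrowth

/-- **Jensen's inequality** on large circles. -/
lemma exists_le_circleAverage_log_norm {h : ℂ → ℂ} (hd : Differentiable ℂ h) :
    ∃ C : ℝ, ∀ r : ℝ, 1 ≤ r → -C ≤ Real.circleAverage (fun z => Real.log ‖h z‖) 0 r := by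
  refine ⟨- Real.log ‖meromorphicTrailingCoeffAt h 0‖, fun r hr => ?_⟩
  have ha : ∀ U, AnalyticOnNhd ℂ h U := fun U z _ => hd.analyticAt z
  have hpos : 0 ≤ MeromorphicOn.divisor h (closedBall 0 |r|) := MeromorphicOn.AnalyticOnNhd.divisor_nonneg (ha _)
  rw [MeromorphicOn.circleAverage_log_norm (by positivity) (ha _).meromorphicOn, neg_neg]
  have h1 : 0 ≤ ∑ᶠ u, (MeromorphicOn.divisor h (closedBall 0 |r|) u : ℝ)
      * Real.log (r * ‖0 - u‖⁻¹) := by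
    refine finsum_nonneg fun u => ?_
    by_cases hu : u ∈ closedBall (0 : ℂ) |r|
    · refine mul_nonneg (by exact_mod_cast hpos u) ?_
      rcases eq_or_ne u 0 with rfl | hu0
      · simp
      · refine Real.log_nonneg ?_
        have : ‖u‖ ≤ r := by simpa [abs_of_pos (lt_of_lt_of_le one_pos hr)] using hu
        rw [zero_sub, norm_neg, ← div_eq_mul_inv, one_le_div (norm_pos_iff.2 hu0)]
        exact this
    · simp [hu]
  have h2 : (0 : ℝ) ≤ (MeromorphicOn.divisor h (closedBall 0 |r|) 0 : ℝ) * Real.log r :=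
    mul_nonneg (by exact_mod_cast hpos 0) (Real.log_nonneg hr)
  linarith

lemma circleIntegrable_log_norm {h : ℂ → ℂ} (hd : Differentiable ℂ h) (r : ℝ) :
    CircleIntegrable (fun z => Real.log ‖h z‖) 0 r :=
  MeromorphicOn.circleIntegrable_log_norm fun z _ => (hd.analyticAt z).meromorphicAt

lemma circleIntegrable_posLog_norm {h : ℂ → ℂ} (hd : Differentiable ℂ h) (r : ℝ) :
    CircleIntegrable (fun z => Real.posLog ‖h z‖) 0 r :=
  MeromorphicOn.circleIntegrable_posLog_norm fun z _ => (hd.analyticAt z).meromorphicAt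

lemma ExpGrowth.exists_circleAverage_posLog_le {s : ℝ} {h : ℂ → ℂ} (hs : 0 ≤ s)
    (hd : Differentiable ℂ h) (hg : ExpGrowth s h) :
    ∃ C : ℝ, 0 ≤ C ∧ ∀ r : ℝ, 1 ≤ r →
      Real.circleAverage (fun z => Real.posLog ‖h z‖) 0 r ≤ C * r ^ s := by
  obtain ⟨C, hC, H⟩ := hg
  refine ⟨C * 2 ^ s, by positivity, fun r hr => ?_⟩
  refine Real.circleAverage_mono_on_of_le_circle (circleIntegrable_posLog_norm hd r) fun z hz => ?_
  have hz : ‖z‖ = r := by simpa [abs_of_pos (lt_of_lt_of_le one_pos hr)] using hz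
  have h1 : Real.posLog ‖h z‖ ≤ C * (1 + ‖z‖) ^ s := by
    rw [Real.posLog_def]
    refine max_le (by positivity) ?_
    beta_reduce
    rcases eq_or_lt_of_le (norm_nonneg (h z)) with h0 | h0
    · rw [← h0, Real.log_zero]; positivity
    · exact (Real.log_le_iff_le_exp h0).2 (H z)
  refine h1.trans ?_
  rw [mul_assoc, ← Real.mul_rpow (by positivity) (by positivity), hz]
  gcongr
  linarith

lemma exists_large_radius_ne_zero {h : ℂ → ℂ} (hd : Differentiable ℂ h) {z₀ : ℂ}
    (hz₀ : h z₀ ≠ 0) (R : ℝ) : ∃ r, R < r ∧ ∀ z : ℂ, ‖z‖ = r → h z ≠ 0 := by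
  have ha : AnalyticOnNhd ℂ h Set.univ := fun z _ => hd.analyticAt z
  have h1 : h ⁻¹' {0}ᶜ ∈ codiscrete ℂ := ha.preimage_zero_mem_codiscrete hz₀
  have h2 : ((fun z : ℂ => ‖z‖) '' (h ⁻¹' {0}ᶜ)ᶜ).Countable :=
    ((HereditarilyLindelofSpace.isLindelof _).countable_of_isDiscrete
      (mem_codiscrete'.1 h1).2).image _
  obtain ⟨r, hr, hrR⟩ := (h2.dense_compl ℝ).exists_mem_open isOpen_Ioi
    (⟨R + 1, lt_add_one R⟩ : (Set.Ioi R).Nonempty)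
  refine ⟨r, hrR, fun z hz hz0 => hr ⟨z, by simpa using hz0, hz⟩⟩

lemma isLittleO_rpow_rpow_atTop_of_lt {s t : ℝ} (hst : s < t) :
    (fun r : ℝ => r ^ s) =o[atTop] fun r : ℝ => r ^ t := by
  refine Asymptotics.isLittleO_of_tendsto' ?_ ?_
  · filter_upwards [eventually_gt_atTop 0] with r hr h
    exact absurd h (Real.rpow_pos_of_pos hr t).ne'
  · refine (tendsto_rpow_neg_atTop (sub_pos.2 hst)).congr' ?_
    filter_upwards [eventually_gt_atTop 0] with r hr
    rw [← Real.rpow_sub hr]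
    ring_nf

lemma eventually_rpow_add_lt_pow {s : ℝ} {N : ℕ} (hsN : s < N) (hN : 0 < N) (A B : ℝ) {δ : ℝ}
    (hδ : 0 < δ) : ∀ᶠ r : ℝ in atTop, A * r ^ s + B < δ * r ^ N := by
  have h1 : (fun r : ℝ => A * r ^ s + B) =o[atTop] fun r : ℝ => r ^ (N : ℝ) := by
    refine ((isLittleO_rpow_rpow_atTop_of_lt hsN).const_mul_left A).add ?_
    have : (0 : ℝ) < N := by exact_mod_cast hN
    simpa using ((isLittleO_rpow_rpow_atTop_of_lt this).const_mul_left B)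
  filter_upwards [h1.def (half_pos hδ), eventually_gt_atTop 0] with r hr hr0
  rw [Real.rpow_natCast, Real.norm_eq_abs, Real.norm_eq_abs, abs_of_pos (a := r ^ N) (by positivity)] at hr
  have : 0 < r ^ N := by positivity
  nlinarith [le_abs_self (A * r ^ s + B)]

/-- An entire function of growth less than `N` which is as small as `exp (-δ |z|^N)` in a sector
vanishes identically. -/
lemma ExpGrowth.eq_zero_of_small_sector {s : ℝ} {h : ℂ → ℂ} {N : ℕ} (hs : 0 ≤ s) (hsN : s < N)
    (hd : Differentiable ℂ h) (hg : ExpGrowth s h) {θ₀ θ₁ δ r₀ : ℝ} (h0 : 0 ≤ θ₀) (h01 : θ₀ < θ₁)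
    (h1 : θ₁ ≤ 2 * Real.pi) (hδ : 0 < δ)
    (H : ∀ r, r₀ ≤ r → ∀ θ ∈ Set.Icc θ₀ θ₁, ‖h (circleMap 0 r θ)‖ ≤ Real.exp (-δ * r ^ N)) :
    ∀ z, h z = 0 := by
  by_contra! hne
  obtain ⟨z₀, hz₀⟩ := hne
  have hN : 0 < N := by
    rcases Nat.eq_zero_or_pos N with rfl | h
    · simp at hsN; linarith
    · exact h
  obtain ⟨C₀, hC₀⟩ := exists_le_circleAverage_log_norm hd
  obtain ⟨C₁, hC₁, hC₁'⟩ := hg.exists_circleAverage_posLog_le hs hd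
  have hlen : 0 < (2 * Real.pi)⁻¹ * (θ₁ - θ₀) := mul_pos (by positivity) (by linarith)
  obtain ⟨R, hR⟩ := eventually_atTop.1 (eventually_rpow_add_lt_pow hsN hN C₁ C₀
    (mul_pos hδ hlen))
  obtain ⟨r, hr, hrz⟩ := exists_large_radius_ne_zero hd hz₀ (max (max R r₀) 1)
  have hrR : R < r := lt_of_le_of_lt ((le_max_left _ _).trans (le_max_left _ _)) hr
  have hr₀ : r₀ < r := lt_of_le_of_lt ((le_max_right _ _).trans (le_max_left _ _)) hr
  have hr1 : 1 < r := lt_of_le_of_lt (le_max_right _ _) hr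
  have key := hR r hrR.le
  have hA := hC₀ r hr1.le
  have hB := hC₁' r hr1.le
  have hind : IntervalIntegrable
      ((Set.Ioc θ₀ θ₁).indicator fun _ => -δ * r ^ N) volume 0 (2 * Real.pi) := by
    rw [intervalIntegrable_iff_integrableOn_Ioc_of_le (by positivity)]
    exact (integrableOn_const (by simp [ENNReal.mul_eq_top])).indicator measurableSet_Ioc
  have hint : ∫ θ in (0 : ℝ)..2 * Real.pi, (Set.Ioc θ₀ θ₁).indicator (fun _ => -δ * r ^ N) θ
      = (θ₁ - θ₀) * (-δ * r ^ N) := by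
    rw [intervalIntegral.integral_of_le (by positivity), setIntegral_indicator measurableSet_Ioc,
      Set.Ioc_inter_Ioc, max_eq_right h0, min_eq_right h1, setIntegral_const]
    simp [h01.le]
  have hle : ∫ θ in (0 : ℝ)..2 * Real.pi, Real.log ‖h (circleMap 0 r θ)‖ ≤
      ∫ θ in (0 : ℝ)..2 * Real.pi, (Real.posLog ‖h (circleMap 0 r θ)‖ +
        (Set.Ioc θ₀ θ₁).indicator (fun _ => -δ * r ^ N) θ) := by
    refine intervalIntegral.integral_mono_on (by positivity) (circleIntegrable_log_norm hd r)
      (IntervalIntegrable.add (circleIntegrable_posLog_norm hd r) hind) fun θ _ => ?_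
    by_cases hθ : θ ∈ Set.Ioc θ₀ θ₁
    · rw [Set.indicator_of_mem hθ]
      have hnz : h (circleMap 0 r θ) ≠ 0 := hrz _ (by simp [abs_of_pos (one_pos.trans hr1)])
      have := (Real.log_le_iff_le_exp (norm_pos_iff.2 hnz)).2
        (H r hr₀.le θ (Set.Ioc_subset_Icc_self hθ))
      linarith [Real.posLog_nonneg (x := ‖h (circleMap 0 r θ)‖)]
    · rw [Set.indicator_of_notMem hθ, add_zero]
      exact le_max_right _ _
  rw [intervalIntegral.integral_add (circleIntegrable_posLog_norm hd r) hind, hint] at hle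
  rw [Real.circleAverage_def, smul_eq_mul] at hA hB
  have h2π : 0 < (2 * Real.pi)⁻¹ := by positivity
  have := mul_le_mul_of_nonneg_left hle h2π.le
  nlinarith

/-- The real part of a polynomial along rays is governed by its coefficient of degree `N`. -/
lemma exists_re_eval_le (p : Polynomial ℂ) (N : ℕ) (hp : p.natDegree ≤ N + 1) :
    ∃ C : ℝ, 0 ≤ C ∧ ∀ r : ℝ, 1 ≤ r → ∀ θ : ℝ, (p.eval (circleMap 0 r θ)).re ≤
      r ^ (N + 1) * (p.coeff (N + 1) * Complex.exp (((N + 1 : ℕ) * θ : ℝ) * Complex.I)).re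
        + C * r ^ N := by
  refine ⟨∑ i ∈ Finset.range (N + 1), ‖p.coeff i‖, by positivity, fun r hr θ => ?_⟩
  rw [Polynomial.eval_eq_sum_range' (Nat.lt_succ_of_le hp), Finset.sum_range_succ, Complex.add_re,
    add_comm]
  refine add_le_add (le_of_eq ?_) ?_
  · rw [← Complex.re_ofReal_mul]
    congr 1
    rw [circleMap_zero, mul_pow, ← Complex.exp_nat_mul]
    push_cast
    ring_nf
  · refine (Complex.re_le_norm _).trans ((norm_sum_le _ _).trans ?_)
    rw [Finset.sum_mul]
    refine Finset.sum_le_sum fun i hi => ?_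
    rw [norm_mul, norm_pow, norm_circleMap_zero, abs_of_pos (one_pos.trans_le hr)]
    gcongr
    exact Nat.lt_succ_iff.1 (Finset.mem_range.1 hi)

/-- Two exponentials of polynomials of degree at most `N` which decay in a common direction cannot
dominate a nonzero entire function of growth less than `N`. -/
lemma ExpGrowth.eq_zero_of_le_exp {s : ℝ} {h g₁ g₂ : ℂ → ℂ} {N : ℕ} (hs : 0 ≤ s)
    (hsN : s < N) (hd : Differentiable ℂ h) (hg : ExpGrowth s h) (hg₁ : ExpGrowth s g₁)
    (hg₂ : ExpGrowth s g₂) {A B : Polynomial ℂ} (hA : A.natDegree ≤ N) (hB : B.natDegree ≤ N)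
    {v : ℂ} (hvA : (A.coeff N * v).re < 0) (hvB : (B.coeff N * v).re < 0)
    (H : ∀ z, h z = g₁ z * Complex.exp (A.eval z) + g₂ z * Complex.exp (B.eval z)) :
    ∀ z, h z = 0 := by
  have hN : 0 < N := by
    rcases Nat.eq_zero_or_pos N with rfl | h
    · simp at hsN; linarith
    · exact h
  obtain ⟨M, rfl⟩ : ∃ M, N = M + 1 := ⟨N - 1, by omega⟩
  have hv : v ≠ 0 := by rintro rfl; simp at hvA
  -- the direction
  obtain ⟨θ₀, hθ₀, hθ₀', hθv⟩ : ∃ θ₀ : ℝ, 0 ≤ θ₀ ∧ θ₀ < 2 * Real.pi ∧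
      Complex.exp (((M + 1 : ℕ) * θ₀ : ℝ) * Complex.I) = v / ‖v‖ := by
    have hpi : 0 < 2 * Real.pi := by positivity
    refine ⟨toIcoMod hpi 0 v.arg / (M + 1 : ℕ), ?_, ?_, ?_⟩
    · exact div_nonneg (by simpa using left_le_toIcoMod hpi 0 v.arg) (by positivity)
    · have h1 := toIcoMod_lt_right hpi 0 v.arg
      have h0 := left_le_toIcoMod hpi 0 v.arg
      refine lt_of_le_of_lt (div_le_self h0 ?_) (by simpa using h1)
      exact_mod_cast hN
    · rw [mul_div_cancel₀ _ (by positivity), toIcoMod]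
      have hn : (‖v‖ : ℂ) ≠ 0 := by exact_mod_cast norm_ne_zero_iff.2 hv
      have h2 : Complex.exp ((v.arg : ℂ) * Complex.I) = v / ‖v‖ := by
        rw [eq_div_iff hn, mul_comm]; exact Complex.norm_mul_exp_arg_mul_I v
      rw [← h2, Complex.exp_eq_exp_iff_exists_int]
      refine ⟨-toIcoDiv hpi 0 v.arg, ?_⟩
      push_cast
      simp only [zsmul_eq_mul]
      ring
  set e : ℝ → ℂ := fun θ => Complex.exp (((M + 1 : ℕ) * θ : ℝ) * Complex.I) with he
  have hcont : Continuous e := by fun_prop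
  have hneg : ∀ a : ℂ, (a * v).re < 0 → (a * e θ₀).re < 0 := by
    intro a ha
    have : a * e θ₀ = ((‖v‖⁻¹ : ℝ) : ℂ) * (a * v) := by
      simp only [he]; rw [hθv]; push_cast; ring
    rw [this, Complex.re_ofReal_mul]
    exact mul_neg_of_pos_of_neg (by positivity) ha
  obtain ⟨δ, hδ, hδA, hδB⟩ : ∃ δ : ℝ, 0 < δ ∧ (A.coeff (M + 1) * e θ₀).re < -δ ∧
      (B.coeff (M + 1) * e θ₀).re < -δ := by
    have h1 := hneg _ hvA
    have h2 := hneg _ hvB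
    refine ⟨min (-(A.coeff (M + 1) * e θ₀).re) (-(B.coeff (M + 1) * e θ₀).re) / 2, ?_, ?_, ?_⟩
    · have := lt_min (neg_pos.2 h1) (neg_pos.2 h2); linarith
    · linarith [min_le_left (-(A.coeff (M + 1) * e θ₀).re) (-(B.coeff (M + 1) * e θ₀).re)]
    · linarith [min_le_right (-(A.coeff (M + 1) * e θ₀).re) (-(B.coeff (M + 1) * e θ₀).re)]
  have hev : ∀ᶠ θ in nhds θ₀, (A.coeff (M + 1) * e θ).re < -δ ∧ (B.coeff (M + 1) * e θ).re < -δ := by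
    have hA' : Continuous fun θ => (A.coeff (M + 1) * e θ).re := by fun_prop
    have hB' : Continuous fun θ => (B.coeff (M + 1) * e θ).re := by fun_prop
    exact (hA'.continuousAt.eventually_lt_const hδA).and (hB'.continuousAt.eventually_lt_const hδB)
  obtain ⟨ε, hε, hεs⟩ := Metric.eventually_nhds_iff.1 hev
  obtain ⟨C₁, hC₁, H₁⟩ := hg₁
  obtain ⟨C₂, hC₂, H₂⟩ := hg₂
  obtain ⟨DA, hDA, HA⟩ := exists_re_eval_le A M hA
  obtain ⟨DB, hDB, HB⟩ := exists_re_eval_le B M hB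
  set t : ℝ := max s M
  have htN : t < ((M + 1 : ℕ) : ℝ) := max_lt hsN (by push_cast; linarith)
  obtain ⟨R, hR⟩ := eventually_atTop.1 (eventually_rpow_add_lt_pow htN hN
    (max C₁ C₂ * 2 ^ s + max DA DB) (Real.log 2) (half_pos hδ))
  refine eq_zero_of_small_sector (N := M + 1) (r₀ := max R 1) (δ := δ / 2)
    (θ₁ := min (θ₀ + ε / 2) (2 * Real.pi)) hs hsN hd hg hθ₀ (lt_min (by linarith) hθ₀')
    (min_le_right _ _) (half_pos hδ) fun r hr θ hθ => ?_
  have hrR : R ≤ r := (le_max_left _ _).trans hr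
  have hr1 : 1 ≤ r := (le_max_right _ _).trans hr
  have hθε : dist θ θ₀ < ε := by
    rw [Real.dist_eq, abs_of_nonneg (by linarith [hθ.1])]
    linarith [hθ.2.trans (min_le_left _ _)]
  have hnorm : ‖circleMap 0 r θ‖ = r := by simp [abs_of_pos (one_pos.trans_le hr1)]
  have hterm : ∀ (C D : ℝ), 0 ≤ C → 0 ≤ D → C ≤ max C₁ C₂ → D ≤ max DA DB → ∀ (g : ℂ → ℂ)
      (P : Polynomial ℂ), (∀ z, ‖g z‖ ≤ Real.exp (C * (1 + ‖z‖) ^ s)) →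
      (P.coeff (M + 1) * e θ).re < -δ →
      (P.eval (circleMap 0 r θ)).re ≤ r ^ (M + 1) * (P.coeff (M + 1) * e θ).re + D * r ^ M →
      ‖g (circleMap 0 r θ) * Complex.exp (P.eval (circleMap 0 r θ))‖ ≤
        Real.exp (-(δ / 2) * r ^ (M + 1) - Real.log 2) := by
    intro C D hC hD hCm hDm g P hg' hP hP'
    rw [norm_mul, Complex.norm_exp]
    refine (mul_le_mul_of_nonneg_right (hg' _) (Real.exp_pos _).le).trans ?_
    rw [← Real.exp_add]
    refine Real.exp_le_exp.2 ?_
    rw [hnorm]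
    have e1 : (1 + r) ^ s ≤ 2 ^ s * r ^ t := by
      calc (1 + r) ^ s ≤ (2 * r) ^ s := by gcongr; linarith
        _ = 2 ^ s * r ^ s := Real.mul_rpow (by norm_num) (by linarith)
        _ ≤ 2 ^ s * r ^ t := by gcongr; exact le_max_left _ _
    have e2 : r ^ M ≤ r ^ t := by
      rw [← Real.rpow_natCast]
      exact Real.rpow_le_rpow_of_exponent_le hr1 (le_max_right _ _)
    have e3 : r ^ (M + 1) * (P.coeff (M + 1) * e θ).re ≤ r ^ (M + 1) * (-δ) := by gcongr
    have e4 : C * (1 + r) ^ s ≤ max C₁ C₂ * (2 ^ s * r ^ t) := by gcongr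
    have e5 : D * r ^ M ≤ max DA DB * r ^ t := by gcongr
    have := hR r hrR
    linarith
  rw [H]
  refine (norm_add_le _ _).trans ?_
  have hs' := hεs hθε
  have t1 := hterm C₁ DA hC₁ hDA (le_max_left _ _) (le_max_left _ _) g₁ A H₁ hs'.1 (HA r hr1 θ)
  have t2 := hterm C₂ DB hC₂ hDB (le_max_right _ _) (le_max_right _ _) g₂ B H₂ hs'.2 (HB r hr1 θ)
  rw [Real.exp_sub, Real.exp_log two_pos] at t1 t2
  linarith

lemma eq_zero_or_eq_zero_of_entire_mul {g h : ℂ → ℂ} (hg : Differentiable ℂ g)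
    (hh : Differentiable ℂ h) (H : ∀ z, g z * h z = 0) : (∀ z, g z = 0) ∨ ∀ z, h z = 0 := by
  have h1 : AnalyticOnNhd ℂ g Set.univ := fun z _ => hg.analyticAt z
  have h2 : AnalyticOnNhd ℂ h Set.univ := fun z _ => hh.analyticAt z
  have := h1.eq_zero_or_eq_zero_of_mul_eq_zero h2 (fun z _ => H z) isPreconnected_univ
  simpa using this

lemma exists_direction (a : ℂ) {b : ℂ} (hb : b ≠ 0) : ∃ v : ℂ,
    ((a * v).re < 0 ∧ (b * v).re < 0) ∨ (0 < (b * v).re ∧ (a * v).re < (b * v).re) := by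
  have hpos : 0 < (b * (starRingEnd ℂ) b).re := by
    rw [Complex.mul_conj]
    exact_mod_cast Complex.normSq_pos.2 hb
  by_cases h : (a * (starRingEnd ℂ) b).re < (b * (starRingEnd ℂ) b).re
  · exact ⟨_, Or.inr ⟨hpos, h⟩⟩
  · refine ⟨-(starRingEnd ℂ) b, Or.inl ?_⟩
    simp only [mul_neg, Complex.neg_re]
    constructor <;> linarith

lemma exp_combination_ne_zero {p₁ p₂ α₁ α₂ : ℂ} (hp₁ : p₁ ≠ 0) (hα : α₁ ≠ α₂) :
    ¬ ∀ z, p₁ * Complex.exp (α₁ * z) + p₂ * Complex.exp (α₂ * z) = 0 := by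
  intro h
  have h0 : p₁ + p₂ = 0 := by simpa using h 0
  have h1 : HasDerivAt (fun z => p₁ * Complex.exp (α₁ * z) + p₂ * Complex.exp (α₂ * z))
      (p₁ * (Complex.exp (α₁ * 0) * (α₁ * 1)) + p₂ * (Complex.exp (α₂ * 0) * (α₂ * 1))) 0 :=
    ((((hasDerivAt_id (0 : ℂ)).const_mul α₁).cexp).const_mul p₁).add
      ((((hasDerivAt_id (0 : ℂ)).const_mul α₂).cexp).const_mul p₂)
  have h2 : (fun z => p₁ * Complex.exp (α₁ * z) + p₂ * Complex.exp (α₂ * z)) = fun _ => 0 :=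
    funext h
  rw [h2] at h1
  have h3 := h1.unique (hasDerivAt_const 0 0)
  simp at h3
  have : p₁ * (α₁ - α₂) = 0 := by linear_combination h3 - α₂ * h0
  exact (mul_ne_zero hp₁ (sub_ne_zero.2 hα)) this

lemma ExpGrowth.exp_mul {σ : ℝ} (hσ : 1 ≤ σ) (α : ℂ) :
    ExpGrowth σ fun z => Complex.exp (α * z) := by
  refine ExpGrowth.mono hσ ⟨‖α‖, norm_nonneg _, fun z => ?_⟩
  rw [Complex.norm_exp, Real.rpow_one]
  refine Real.exp_le_exp.2 ((Complex.re_le_norm _).trans ?_)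
  rw [norm_mul]
  gcongr
  linarith

/-- If `H e^P` solves the equation, with `H` of growth smaller than `deg P`, then `P` and `Q`
have degree at most one. -/
lemma natDegree_le_one_of_equation {s : ℝ} {c w p₁ p₂ α₁ α₂ : ℂ} (hw : w ≠ 0) (hp₁ : p₁ ≠ 0)
    (hα : α₁ ≠ α₂) {q Q P : Polynomial ℂ} (hq : q ≠ 0) {f H : ℂ → ℂ}
    (hH : Differentiable ℂ H) (hHg : ExpGrowth s H) (hs : 0 < s) (hsP : s < P.natDegree)
    (hfH : ∀ z, f z = H z * Complex.exp (P.eval z)) (hH0 : ¬ ∀ z, H z = 0)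
    (heq : ∀ z : ℂ, f z ^ 2 + w * f z * deriv f z
        + q.eval z * Complex.exp (Q.eval z) * f (z + c)
      = p₁ * Complex.exp (α₁ * z) + p₂ * Complex.exp (α₂ * z)) :
    P.natDegree ≤ 1 ∧ Q.natDegree ≤ 1 := by
  rw [← max_le_iff]
  by_contra! hN2
  set N := max P.natDegree Q.natDegree with hN
  have hPN : P.natDegree ≤ N := le_max_left _ _
  have hQN : Q.natDegree ≤ N := le_max_right _ _
  set σ : ℝ := max s 1
  have hσ0 : 0 < σ := lt_max_of_lt_left hs
  have hσN : σ < N := by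
    refine max_lt (hsP.trans_le (by exact_mod_cast hPN)) (by exact_mod_cast hN2)
  have hHσ : ExpGrowth σ H := hHg.mono (le_max_left _ _)
  set Pc : Polynomial ℂ := P.comp (Polynomial.X + Polynomial.C c) with hPc
  have hPcd : Pc.natDegree = P.natDegree := by
    rw [hPc, Polynomial.natDegree_comp, Polynomial.natDegree_X_add_C, mul_one]
  have hPce : ∀ z, Pc.eval z = P.eval (z + c) := fun z => by simp [hPc]
  set R : Polynomial ℂ := Q + Pc with hR
  set S : Polynomial ℂ := P + P with hS
  have hRN : R.natDegree ≤ N := Polynomial.natDegree_add_le_of_degree_le hQN (hPcd.trans_le hPN)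
  have hSN : S.natDegree ≤ N := Polynomial.natDegree_add_le_of_degree_le hPN hPN
  have hPd : Differentiable ℂ fun z => P.derivative.eval z := P.derivative.differentiable
  -- the three coefficient functions
  set L : ℂ → ℂ := fun z => H z + w * (deriv H z + P.derivative.eval z * H z) with hL
  set a : ℂ → ℂ := fun z => H z * L z with ha
  set b : ℂ → ℂ := fun z => q.eval z * H (z + c) with hb
  set E : ℂ → ℂ := fun z => p₁ * Complex.exp (α₁ * z) + p₂ * Complex.exp (α₂ * z) with hE
  have hLd : Differentiable ℂ L :=
    hH.add (((hH.contDiff.differentiable_deriv_two).add (hPd.mul hH)).const_mul w)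
  have had : Differentiable ℂ a := hH.mul hLd
  have hHc : Differentiable ℂ fun z => H (z + c) := hH.comp (differentiable_id.add_const c)
  have hbd : Differentiable ℂ b := q.differentiable.mul hHc
  have hEd : Differentiable ℂ E := by fun_prop
  have hLg : ExpGrowth σ L := hHσ.add hσ0.le ((ExpGrowth.const hσ0.le w).mul
    ((hHσ.deriv hσ0.le hH).add hσ0.le ((ExpGrowth.polynomial hσ0 _).mul hHσ)))
  have hag : ExpGrowth σ a := hHσ.mul hLg
  have hbg : ExpGrowth σ b := (ExpGrowth.polynomial hσ0 _).mul (hHσ.comp_add hσ0.le c)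
  have hEg : ExpGrowth σ E :=
    ((ExpGrowth.const hσ0.le p₁).mul (ExpGrowth.exp_mul (le_max_right _ _) α₁)).add hσ0.le
      ((ExpGrowth.const hσ0.le p₂).mul (ExpGrowth.exp_mul (le_max_right _ _) α₂))
  have hneg : ∀ {g : ℂ → ℂ}, ExpGrowth σ g → ExpGrowth σ fun z => -1 * g z :=
    fun hg => (ExpGrowth.const hσ0.le (-1)).mul hg
  have hE0 : ¬ ∀ z, E z = 0 := exp_combination_ne_zero hp₁ hα
  have hb0 : ¬ ∀ z, b z = 0 := by
    intro h
    rcases eq_zero_or_eq_zero_of_entire_mul q.differentiable hHc h with h | h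
    · exact hq (Polynomial.funext (by simpa using h))
    · exact hH0 fun z => by simpa using h (z - c)
  have key : ∀ z, a z * Complex.exp (S.eval z) + b z * Complex.exp (R.eval z) = E z := by
    intro z
    have hd : deriv f z = deriv H z * Complex.exp (P.eval z)
        + H z * (Complex.exp (P.eval z) * P.derivative.eval z) := by
      rw [funext hfH]
      exact ((hH z).hasDerivAt.mul (P.hasDerivAt z).cexp).deriv
    have := heq z
    rw [hd, hfH, hfH] at this
    simp only [ha, hb, hE, hL, hS, hR, Polynomial.eval_add, Complex.exp_add, hPce]
    rw [← this]
    ring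
  have hmul : ∀ T U : Polynomial ℂ, ∀ z, Complex.exp ((T - U).eval z) * Complex.exp (U.eval z) =
      Complex.exp (T.eval z) := by
    intro T U z
    rw [← Complex.exp_add]; simp
  have hmul' : ∀ U : Polynomial ℂ, ∀ z, Complex.exp ((-U).eval z) * Complex.exp (U.eval z) = 1 := by
    intro U z
    rw [← Complex.exp_add]; simp
  by_cases hRc : R.coeff N = 0
  · have hSc : S.coeff N ≠ 0 := by
      rcases hPN.lt_or_eq with hlt | heq'
      · exfalso
        have hQ : Q.natDegree = N := by
          rcases max_choice P.natDegree Q.natDegree with h | h <;> omega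
        rw [hR, Polynomial.coeff_add, Polynomial.coeff_eq_zero_of_natDegree_lt (hPcd.trans_lt hlt),
          add_zero, ← hQ] at hRc
        have : Q = 0 := Polynomial.leadingCoeff_eq_zero.1 hRc
        rw [this, Polynomial.natDegree_zero] at hQ
        omega
      · rw [hS, Polynomial.coeff_add, ← two_mul]
        refine mul_ne_zero two_ne_zero ?_
        rw [← heq']
        intro h
        have : P = 0 := Polynomial.leadingCoeff_eq_zero.1 h
        rw [this, Polynomial.natDegree_zero] at heq'
        omega
    obtain ⟨v, hv⟩ := exists_direction 0 hSc
    have hv : 0 < (S.coeff N * v).re := by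
      rcases hv with h | h
      · simp at h
      · exact h.1
    have ha0 : ∀ z, a z = 0 := by
      refine hag.eq_zero_of_le_exp (A := -S) (B := R - S) (v := v) hσ0.le hσN had hEg (hneg hbg)
        (by simpa using hSN) ((Polynomial.natDegree_sub_le _ _).trans (max_le hRN hSN)) ?_ ?_ ?_
      · simpa using hv
      · simpa [hRc] using hv
      · intro z
        have h1 := hmul R S z
        have h2 := hmul' S z
        refine mul_right_cancel₀ (Complex.exp_ne_zero (S.eval z)) ?_
        linear_combination key z - b z * h1 * (-1) - E z * h2
    rcases eq_zero_or_eq_zero_of_entire_mul hH hLd ha0 with h | hL0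
    · exact hH0 h
    -- `H` is an exponential of a polynomial of degree `N`
    set T : Polynomial ℂ := Polynomial.C w⁻¹ * Polynomial.X + P with hT
    have hconst : ∀ z, H z * Complex.exp (T.eval z) = H 0 * Complex.exp (T.eval 0) := by
      intro z
      refine is_const_of_deriv_eq_zero (f := fun z => H z * Complex.exp (T.eval z))
        (hH.mul T.differentiable.cexp) (fun x => ?_) z 0
      rw [((hH x).hasDerivAt.fun_mul (T.hasDerivAt x).cexp).deriv]
      have h1 := hL0 x
      simp only [hL] at h1
      have h2 : T.derivative.eval x = w⁻¹ + P.derivative.eval x := by simp [hT]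
      rw [h2]
      have h3 : deriv H x + H x * (w⁻¹ + P.derivative.eval x) = 0 := by
        refine (mul_eq_zero.1 (?_ : w * _ = 0)).resolve_left hw
        linear_combination h1 + H x * mul_inv_cancel₀ hw
      linear_combination Complex.exp (T.eval x) * h3
    have hTN : (-T).natDegree ≤ N := by
      rw [Polynomial.natDegree_neg]
      refine Polynomial.natDegree_add_le_of_degree_le ?_ hPN
      exact (Polynomial.natDegree_C_mul_le _ _).trans (by rw [Polynomial.natDegree_X]; omega)
    have hTc : ((-T).coeff N * v).re < 0 := by
      have h1 : T.coeff N = P.coeff N := by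
        rw [hT, Polynomial.coeff_add, Polynomial.coeff_C_mul, Polynomial.coeff_X,
          if_neg (by omega)]
        ring
      rw [hS, Polynomial.coeff_add, add_mul, Complex.add_re] at hv
      rw [Polynomial.coeff_neg, h1, neg_mul, Complex.neg_re]
      linarith
    refine hH0 (hHσ.eq_zero_of_le_exp (A := -T) (B := -T) (v := v) hσ0.le hσN hH
      (ExpGrowth.const hσ0.le (H 0 * Complex.exp (T.eval 0))) (ExpGrowth.const hσ0.le 0) hTN hTN
      hTc hTc fun z => ?_)
    refine mul_right_cancel₀ (Complex.exp_ne_zero (T.eval z)) ?_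
    have h2 := hmul' T z
    linear_combination hconst z - H 0 * Complex.exp (T.eval 0) * h2
  · obtain ⟨v, ⟨h1, h2⟩ | ⟨h1, h2⟩⟩ := exists_direction (S.coeff N) hRc
    · exact hE0 (hEg.eq_zero_of_le_exp hσ0.le hσN hEd hag hbg hSN hRN h1 h2
        fun z => (key z).symm)
    · refine hb0 (hbg.eq_zero_of_le_exp (A := -R) (B := S - R) (v := v) hσ0.le hσN hbd hEg
        (hneg hag) (by simpa using hRN)
        ((Polynomial.natDegree_sub_le _ _).trans (max_le hSN hRN)) ?_ ?_ ?_)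
      · simpa using h1
      · simp only [Polynomial.coeff_sub, sub_mul, Complex.sub_re]; linarith
      · intro z
        have h1 := hmul S R z
        have h2 := hmul' R z
        refine mul_right_cancel₀ (Complex.exp_ne_zero (R.eval z)) ?_
        linear_combination key z + a z * h1 - E z * h2

lemma coeff_cauchyPowerSeries_eq_circleAverage {g : ℂ → ℂ} (hg : Differentiable ℂ g) (n : ℕ) {r : ℝ}
    (hr : 0 < r) : (cauchyPowerSeries g 0 1).coeff n
      = Real.circleAverage (fun z => (1 / z) ^ n * g z) 0 r := by
  have h1 := (hg.hasFPowerSeriesOnBall 0 (R := 1) one_pos).hasFPowerSeriesAt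
  have h2 := (hg.hasFPowerSeriesOnBall 0 (R := r.toNNReal) (by simpa using hr)).hasFPowerSeriesAt
  have h3 := h1.eq_formalMultilinearSeries h2
  rw [NNReal.coe_one, Real.coe_toNNReal _ hr.le] at h3
  rw [h3, Real.circleAverage_eq_circleIntegral hr.ne']
  have h4 := cauchyPowerSeries_apply g 0 r n 1
  rw [FormalMultilinearSeries.apply_eq_pow_smul_coeff, one_pow, one_smul] at h4
  rw [h4]
  congr 2
  ext z
  simp only [sub_zero, smul_eq_mul]
  ring

/-- Taylor coefficients of an entire function are controlled by its real part. -/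
lemma norm_coeff_mul_pow_le {g : ℂ → ℂ} (hg : Differentiable ℂ g) {n : ℕ} (hn : n ≠ 0) {r : ℝ}
    (hr : 0 < r) : ‖(cauchyPowerSeries g 0 1).coeff n‖ * r ^ n
      ≤ 2 * Real.circleAverage (fun z => |(g z).re|) 0 r := by
  have hc : Continuous g := hg.continuous
  have hz : ∀ z ∈ sphere (0 : ℂ) r, z ≠ 0 := fun z hz => ne_zero_of_mem_sphere hr.ne' ⟨z, hz⟩
  have hzn : ∀ z ∈ sphere (0 : ℂ) r, ‖z‖ = r := fun z hz => by simpa using hz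
  have hci : ContinuousOn (fun z : ℂ => 1 / z) (sphere (0 : ℂ) r) :=
    continuousOn_const.div continuousOn_id hz
  -- the conjugate part averages to zero
  have hconj : Real.circleAverage (fun z => (1 / z) ^ n * (starRingEnd ℂ) (g z)) 0 r = 0 := by
    have h1 : Real.circleAverage (fun z => (1 / z) ^ n * (starRingEnd ℂ) (g z)) 0 r
        = Real.circleAverage (Complex.conjCLE.toContinuousLinearMap ∘
          fun z => ((r : ℂ) ^ (2 * n))⁻¹ * z ^ n * g z) 0 r := by
      refine Real.circleAverage_congr_sphere fun z hz' => ?_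
      rw [abs_of_pos hr] at hz'
      have h2 : z * (starRingEnd ℂ) z = (r : ℂ) ^ 2 := by
        rw [Complex.mul_conj, Complex.normSq_eq_norm_sq, hzn z hz']; push_cast; rfl
      have h3 : (starRingEnd ℂ) z = r ^ 2 / z := by
        rw [← h2]; field_simp [hz z hz']
      have hr' : (r : ℂ) ≠ 0 := by exact_mod_cast hr.ne'
      simp only [Function.comp_apply, ContinuousLinearEquiv.coe_coe, Complex.conjCLE_apply,
        map_mul, map_inv₀, map_pow, Complex.conj_ofReal, h3]
      rw [div_pow, div_pow, one_pow, ← pow_mul]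
      field_simp
    rw [h1, ContinuousLinearMap.circleAverage_comp_comm, DiffContOnCl.circleAverage]
    · simp [hn]
    · exact Differentiable.diffContOnCl (by fun_prop)
    · exact (Continuous.continuousOn (by fun_prop)).circleIntegrable hr.le
  have hsum : (cauchyPowerSeries g 0 1).coeff n
      = 2 * Real.circleAverage (fun z => (1 / z) ^ n * ((g z).re : ℂ)) 0 r := by
    rw [coeff_cauchyPowerSeries_eq_circleAverage hg n hr,
      ← add_zero (Real.circleAverage (fun z => (1 / z) ^ n * g z) 0 r)]
    nth_rewrite 2 [← hconj]
    rw [← Real.circleAverage_fun_add, ← smul_eq_mul (2 : ℂ), ← Real.circleAverage_fun_smul]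
    · congr 1
      ext z
      rw [← mul_add, Complex.add_conj, smul_eq_mul]
      push_cast; ring
    · exact ((hci.pow n).mul hc.continuousOn).circleIntegrable hr.le
    · exact ((hci.pow n).mul (Complex.continuous_conj.comp hc).continuousOn).circleIntegrable hr.le
  rw [hsum, norm_mul, Complex.norm_ofNat, mul_assoc]
  gcongr
  rw [Real.circleAverage_def, Real.circleAverage_def, norm_smul, smul_eq_mul, Real.norm_of_nonneg
    (by positivity), mul_assoc]
  gcongr
  have h5 := intervalIntegral.norm_integral_le_integral_norm (a := 0) (b := 2 * Real.pi)
    (f := fun θ => (1 / circleMap 0 r θ) ^ n * ((g (circleMap 0 r θ)).re : ℂ)) (μ := volume)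
    (by positivity)
  calc _ ≤ _ := mul_le_mul_of_nonneg_right h5 (by positivity)
    _ = _ := by
      rw [← intervalIntegral.integral_mul_const]
      congr 1
      ext θ
      rw [norm_mul, norm_pow, norm_div, norm_one, norm_circleMap_zero, abs_of_pos hr,
        Complex.norm_real, Real.norm_eq_abs, one_div, inv_pow, mul_right_comm,
        inv_mul_cancel₀ (by positivity), one_mul]

/-- A Liouville theorem: an entire function whose real part has small circle averages for
arbitrarily large radii is a polynomial. -/
lemma exists_polynomial_of_circleAverage_abs_re_le {g : ℂ → ℂ} (hg : Differentiable ℂ g)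
    {t C : ℝ} (ht : 0 ≤ t)
    (h : ∃ᶠ r in atTop, Real.circleAverage (fun z => |(g z).re|) 0 r ≤ C * r ^ t) :
    ∃ P : Polynomial ℂ, (P.natDegree : ℝ) ≤ t ∧ ∀ z, g z = P.eval z := by
  set a := (cauchyPowerSeries g 0 1).coeff with ha
  have hzero : ∀ n : ℕ, t < n → a n = 0 := by
    intro n hn
    have hn0 : n ≠ 0 := by rintro rfl; simp at hn; linarith
    by_contra hne
    have hpos : 0 < ‖a n‖ := norm_pos_iff.2 hne
    have h1 := (isLittleO_rpow_rpow_atTop_of_lt hn).def (c := ‖a n‖ / (4 * (|C| + 1)))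
      (by positivity)
    obtain ⟨r, hr, hr1, hr0⟩ := (h.and_eventually (h1.and (eventually_gt_atTop 0))).exists
    have h2 := norm_coeff_mul_pow_le hg hn0 hr0
    rw [Real.norm_of_nonneg (by positivity), Real.norm_of_nonneg (by positivity),
      Real.rpow_natCast] at hr1
    have h3 : C * r ^ t ≤ (|C| + 1) * r ^ t := by
      gcongr; linarith [le_abs_self C]
    have h4 : (|C| + 1) * r ^ t ≤ ‖a n‖ / 4 * r ^ n := by
      calc _ ≤ (|C| + 1) * (‖a n‖ / (4 * (|C| + 1)) * r ^ n) := by gcongr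
        _ = _ := by field_simp
    have h5 : 0 < ‖a n‖ * r ^ n := by positivity
    change ‖a n‖ * r ^ n ≤ _ at h2
    linarith
  refine ⟨∑ i ∈ Finset.range (⌊t⌋₊ + 1), Polynomial.monomial i (a i), ?_, fun z => ?_⟩
  · have h1 : (∑ i ∈ Finset.range (⌊t⌋₊ + 1), Polynomial.monomial i (a i)).natDegree ≤ ⌊t⌋₊ := by
      refine Polynomial.natDegree_sum_le_of_forall_le _ _ fun i hi => ?_
      exact (Polynomial.natDegree_monomial_le _).trans
        (Nat.lt_succ_iff.1 (Finset.mem_range.1 hi))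
    exact (Nat.cast_le.2 h1).trans (Nat.floor_le ht)
  · have h1 := (hg.hasFPowerSeriesOnBall 0 (R := 1) one_pos).hasSum (y := z) (by simp)
    simp only [FormalMultilinearSeries.apply_eq_pow_smul_coeff, NNReal.coe_one, zero_add,
      smul_eq_mul, ← ha] at h1
    have h2 : HasSum (fun n => z ^ n * a n) (∑ n ∈ Finset.range (⌊t⌋₊ + 1), z ^ n * a n) := by
      refine hasSum_sum_of_ne_finset_zero fun n hn => ?_
      rw [hzero n ((Nat.lt_floor_add_one t).trans_le ?_), mul_zero]
      simp at hn
      exact_mod_cast hn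
    rw [h1.unique h2, Polynomial.eval_finsetSum]
    refine Finset.sum_congr rfl fun i _ => ?_
    rw [Polynomial.eval_monomial, mul_comm]

lemma exists_polynomial_of_eq_mul_exp {f H g : ℂ → ℂ} (hf : Differentiable ℂ f)
    (hH : Differentiable ℂ H) (hg : Differentiable ℂ g) (hfH : ∀ z, f z = H z * Complex.exp (g z))
    {t C : ℝ} (ht : 0 ≤ t) (hHg : ExpGrowth t H) (hH0 : ¬ ∀ z, H z = 0)
    (h : ∀ᶠ r in atTop, Real.circleAverage (fun z => Real.posLog ‖f z‖) 0 r ≤ C * r ^ t) :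
    ∃ P : Polynomial ℂ, (P.natDegree : ℝ) ≤ t ∧ ∀ z, g z = P.eval z := by
  obtain ⟨D, hD, hDH⟩ := hHg.exists_circleAverage_posLog_le ht hH
  obtain ⟨c₁, hc₁⟩ := exists_le_circleAverage_log_norm hH
  obtain ⟨c₂, hc₂⟩ := exists_le_circleAverage_log_norm hf
  have hfreq : ∃ᶠ r : ℝ in atTop, ∀ z ∈ sphere (0 : ℂ) r, H z ≠ 0 := by
    obtain ⟨z₀, hz₀⟩ := not_forall.1 hH0
    refine frequently_atTop.2 fun R => ?_
    obtain ⟨r, hr, hrz⟩ := exists_large_radius_ne_zero hH hz₀ R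
    exact ⟨r, hr.le, fun z hz => hrz z (by simpa using hz)⟩
  refine exists_polynomial_of_circleAverage_abs_re_le hg (C := 2 * C + 2 * D + |c₁| + |c₂|) ht ?_
  refine (hfreq.and_eventually (h.and (eventually_ge_atTop 1))).mono fun r ⟨hr, hfr, hr1⟩ => ?_
  have hr0 : 0 < r := one_pos.trans_le hr1
  have i1 := circleIntegrable_posLog_norm hf r
  have i2 := circleIntegrable_posLog_norm hH r
  have i3 := circleIntegrable_log_norm hf r
  have i4 := circleIntegrable_log_norm hH r
  have hpt : Real.circleAverage (fun z => |(g z).re|) 0 r ≤ Real.circleAverage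
      ((((2 : ℝ) • fun z => Real.posLog ‖f z‖) - fun z => Real.log ‖f z‖) +
      (((2 : ℝ) • fun z => Real.posLog ‖H z‖) - fun z => Real.log ‖H z‖)) 0 r := by
    refine Real.circleAverage_mono ?_ ?_ fun z hz => ?_
    · exact (Continuous.continuousOn
        (Complex.continuous_re.comp hg.continuous).abs).circleIntegrable hr0.le
    · exact ((i1.const_smul).sub i3).add ((i2.const_smul).sub i4)
    · rw [abs_of_pos hr0] at hz
      have h1 : Real.log ‖f z‖ = Real.log ‖H z‖ + (g z).re := by
        rw [hfH, norm_mul, Real.log_mul (norm_ne_zero_iff.2 (hr z hz))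
          (norm_ne_zero_iff.2 (Complex.exp_ne_zero _)), Complex.norm_exp, Real.log_exp]
      have h2 : Real.log ‖f z‖ ≤ Real.posLog ‖f z‖ := le_max_right _ _
      have h3 : Real.log ‖H z‖ ≤ Real.posLog ‖H z‖ := le_max_right _ _
      have h4 : 0 ≤ Real.posLog ‖f z‖ := le_max_left _ _
      have h5 : 0 ≤ Real.posLog ‖H z‖ := le_max_left _ _
      simp only [Pi.add_apply, Pi.sub_apply, Pi.smul_apply, smul_eq_mul]
      rw [abs_le]
      constructor <;> linarith
  rw [Real.circleAverage_add ((i1.const_smul).sub i3) ((i2.const_smul).sub i4),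
    Real.circleAverage_sub i1.const_smul i3, Real.circleAverage_sub i2.const_smul i4,
    Real.circleAverage_smul, Real.circleAverage_smul, smul_eq_mul, smul_eq_mul] at hpt
  have h1 := hDH r hr1
  have h2 := hc₁ r hr1
  have h3 := hc₂ r hr1
  have h4 : 1 ≤ r ^ t := Real.one_le_rpow hr1 ht
  nlinarith [le_abs_self c₁, le_abs_self c₂, abs_nonneg c₁, abs_nonneg c₂]

/-- The Weierstrass primary factor `E_p(u) = (1 - u) exp(u + u²/2 + ⋯ + u^p/p)`. -/
def primaryFactor (p : ℕ) (u : ℂ) : ℂ := (1 - u) * Complex.exp (-Complex.logTaylor (p + 1) (-u))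

lemma differentiable_logTaylor (n : ℕ) : Differentiable ℂ (Complex.logTaylor n) := by
  unfold Complex.logTaylor
  fun_prop

lemma differentiable_primaryFactor (p : ℕ) : Differentiable ℂ (primaryFactor p) := by
  have := differentiable_logTaylor (p + 1)
  unfold primaryFactor
  fun_prop

lemma primaryFactor_ne_zero {p : ℕ} {u : ℂ} (hu : u ≠ 1) : primaryFactor p u ≠ 0 :=
  mul_ne_zero (sub_ne_zero.2 hu.symm) (Complex.exp_ne_zero _)

lemma exists_primaryFactor_eq_exp {s : ℝ} (hs : 0 < s) {u : ℂ} (hu : ‖u‖ ≤ 1 / 2) :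
    ∃ v : ℂ, primaryFactor ⌊s⌋₊ u = Complex.exp v ∧ ‖v‖ ≤ 1 ∧ ‖v‖ ≤ 2 * ‖u‖ ^ s := by
  have hu1 : ‖-u‖ < 1 := by rw [norm_neg]; linarith
  have h1 := Complex.norm_log_sub_logTaylor_le ⌊s⌋₊ hu1
  have hne : 1 + -u ≠ 0 := Complex.slitPlane_ne_zero (Complex.mem_slitPlane_of_norm_lt_one hu1)
  have h2 : (1 - ‖-u‖)⁻¹ ≤ 2 := by
    rw [norm_neg, inv_le_comm₀ (by linarith) two_pos]; linarith
  have h0 := norm_nonneg u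
  have h3 : ‖Complex.log (1 + -u) - Complex.logTaylor (⌊s⌋₊ + 1) (-u)‖
      ≤ 2 * ‖u‖ ^ (⌊s⌋₊ + 1) := by
    refine h1.trans ?_
    calc ‖-u‖ ^ (⌊s⌋₊ + 1) * (1 - ‖-u‖)⁻¹ / (⌊s⌋₊ + 1)
        ≤ ‖-u‖ ^ (⌊s⌋₊ + 1) * (1 - ‖-u‖)⁻¹ :=
          div_le_self (mul_nonneg (by positivity) (inv_nonneg.2 (by linarith)))
            (by linarith [(Nat.cast_nonneg ⌊s⌋₊ : (0 : ℝ) ≤ _)])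
      _ ≤ ‖u‖ ^ (⌊s⌋₊ + 1) * 2 := by rw [norm_neg] at h2 ⊢; gcongr
      _ = _ := mul_comm _ _
  refine ⟨_, ?_, h3.trans ?_, h3.trans ?_⟩
  · rw [sub_eq_add_neg, Complex.exp_add, Complex.exp_log hne, primaryFactor, sub_eq_add_neg]
  · have : ‖u‖ ^ (⌊s⌋₊ + 1) ≤ ‖u‖ ^ 1 :=
      pow_le_pow_of_le_one h0 (by linarith) (by omega)
    rw [pow_one] at this
    linarith
  · rw [← Real.rpow_natCast]
    gcongr 2 * ?_
    rcases h0.eq_or_lt with h0 | h0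
    · rw [← h0, Real.zero_rpow (by positivity), Real.zero_rpow hs.ne']
    · exact Real.rpow_le_rpow_of_exponent_ge h0 (by linarith)
        (by push_cast; exact (Nat.lt_floor_add_one s).le)

lemma norm_primaryFactor_sub_one_le {s : ℝ} (hs : 0 < s) {u : ℂ} (hu : ‖u‖ ≤ 1 / 2) :
    ‖primaryFactor ⌊s⌋₊ u - 1‖ ≤ 4 * ‖u‖ ^ s := by
  obtain ⟨v, hv, hv1, hvs⟩ := exists_primaryFactor_eq_exp hs hu
  rw [hv]
  linarith [Complex.norm_exp_sub_one_le hv1]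

lemma exists_norm_primaryFactor_le {s : ℝ} (hs : 0 < s) :
    ∃ C : ℝ, 0 ≤ C ∧ ∀ u, ‖primaryFactor ⌊s⌋₊ u‖ ≤ Real.exp (C * ‖u‖ ^ s) := by
  refine ⟨2 + (3 ^ s / s + (⌊s⌋₊ + 1) * 2 ^ s), by positivity, fun u => ?_⟩
  have h0 := norm_nonneg u
  have hus : 0 ≤ ‖u‖ ^ s := by positivity
  rcases le_or_gt ‖u‖ (1 / 2) with hu | hu
  · obtain ⟨v, hv, -, hvs⟩ := exists_primaryFactor_eq_exp hs hu
    rw [hv]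
    refine (Complex.norm_exp_le_exp_norm v).trans (Real.exp_le_exp.2 (hvs.trans ?_))
    gcongr
    exact le_add_of_nonneg_right (by positivity)
  · have h1 : ‖1 - u‖ ≤ Real.exp (3 ^ s / s * ‖u‖ ^ s) := by
      calc ‖1 - u‖ ≤ 3 * ‖u‖ := by
            have := norm_sub_le 1 u
            rw [norm_one] at this; linarith
        _ = Real.exp (Real.log (3 * ‖u‖)) := (Real.exp_log (by positivity)).symm
        _ ≤ _ := by
          gcongr
          refine (Real.log_le_rpow_div (by positivity) hs).trans ?_
          rw [Real.mul_rpow (by norm_num) h0, mul_div_right_comm]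
    have h2 : ‖Complex.logTaylor (⌊s⌋₊ + 1) (-u)‖ ≤ (⌊s⌋₊ + 1) * 2 ^ s * ‖u‖ ^ s := by
      have h3 : ∀ j ∈ Finset.range (⌊s⌋₊ + 1), ‖(-1 : ℂ) ^ (j + 1) * (-u) ^ j / j‖
          ≤ 2 ^ s * ‖u‖ ^ s := by
        intro j hj
        have hjs : (j : ℝ) ≤ s :=
          (Nat.cast_le.2 (Nat.lt_succ_iff.1 (Finset.mem_range.1 hj))).trans (Nat.floor_le hs.le)
        rw [norm_div, norm_mul, norm_pow, norm_pow, norm_neg, norm_neg, norm_one, one_pow,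
          one_mul, Complex.norm_natCast, ← Real.mul_rpow two_pos.le h0]
        rcases Nat.eq_zero_or_pos j with rfl | hj0
        · simp; positivity
        · calc ‖u‖ ^ j / j ≤ ‖u‖ ^ j := div_le_self (by positivity) (by exact_mod_cast hj0)
            _ ≤ (2 * ‖u‖) ^ j := by gcongr; linarith
            _ = (2 * ‖u‖) ^ (j : ℝ) := (Real.rpow_natCast _ _).symm
            _ ≤ _ := Real.rpow_le_rpow_of_exponent_le (by linarith) hjs
      have h4 := norm_sum_le_of_le _ h3
      rw [Finset.sum_const, Finset.card_range, nsmul_eq_mul] at h4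
      rw [Complex.logTaylor]
      refine h4.trans (le_of_eq ?_)
      push_cast; ring
    rw [primaryFactor, norm_mul]
    calc _ ≤ Real.exp (3 ^ s / s * ‖u‖ ^ s) * Real.exp ((⌊s⌋₊ + 1) * 2 ^ s * ‖u‖ ^ s) := by
          gcongr
          refine (Complex.norm_exp_le_exp_norm _).trans (Real.exp_le_exp.2 ?_)
          rwa [norm_neg]
      _ ≤ _ := by
        rw [← Real.exp_add]
        gcongr
        nlinarith

section CanonicalProduct

variable {ι : Type*} {a : ι → ℂ} {s : ℝ}

/-- The canonical product of genus `⌊s⌋₊` with zeros `a i`. -/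
def canonicalProduct (s : ℝ) (a : ι → ℂ) (z : ℂ) : ℂ := ∏' i, primaryFactor ⌊s⌋₊ (z / a i)

lemma eventually_cofinite_le_norm (hs : 0 < s) (ha : ∀ i, a i ≠ 0)
    (hsum : Summable fun i => ‖a i‖ ^ (-s)) (R : ℝ) : ∀ᶠ i in cofinite, R ≤ ‖a i‖ := by
  rcases le_or_gt R 0 with hR | hR
  · exact Eventually.of_forall fun i => hR.trans (norm_nonneg _)
  · filter_upwards [hsum.tendsto_cofinite_zero.eventually_lt_const (Real.rpow_pos_of_pos hR (-s))]
      with i hi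
    by_contra hlt
    exact absurd (Real.rpow_le_rpow_of_nonpos (norm_pos_iff.2 (ha i)) (not_le.1 hlt).le
      (by linarith : -s ≤ 0)) (not_le.2 hi)

lemma eventually_cofinite_norm_primaryFactor_sub_one_le (hs : 0 < s) (ha : ∀ i, a i ≠ 0)
    (hsum : Summable fun i => ‖a i‖ ^ (-s)) (R : ℝ) :
    ∀ᶠ i in cofinite, ∀ z ∈ ball (0 : ℂ) R,
      ‖primaryFactor ⌊s⌋₊ (z / a i) - 1‖ ≤ 4 * R ^ s * ‖a i‖ ^ (-s) := by
  filter_upwards [eventually_cofinite_le_norm hs ha hsum (2 * R)] with i hi z hz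
  rw [mem_ball_zero_iff] at hz
  have hai := norm_pos_iff.2 (ha i)
  have h1 : ‖z / a i‖ ≤ 1 / 2 := by
    rw [norm_div, div_le_iff₀ hai]; linarith
  refine (norm_primaryFactor_sub_one_le hs h1).trans ?_
  rw [norm_div, Real.div_rpow (norm_nonneg _) hai.le, Real.rpow_neg hai.le, div_eq_mul_inv,
    mul_assoc]
  gcongr

lemma hasProdLocallyUniformlyOn_primaryFactor (hs : 0 < s) (ha : ∀ i, a i ≠ 0)
    (hsum : Summable fun i => ‖a i‖ ^ (-s)) (R : ℝ) :
    HasProdLocallyUniformlyOn (fun i z => primaryFactor ⌊s⌋₊ (z / a i)) (canonicalProduct s a)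
      (ball (0 : ℂ) R) := by
  have hd := differentiable_primaryFactor ⌊s⌋₊
  have := Summable.hasProdLocallyUniformlyOn_one_add (K := ball (0 : ℂ) R) isOpen_ball
    (f := fun i z => primaryFactor ⌊s⌋₊ (z / a i) - 1) (hsum.mul_left (4 * R ^ s))
    (eventually_cofinite_norm_primaryFactor_sub_one_le hs ha hsum R)
    (fun i => Continuous.continuousOn (by have := hd.continuous; fun_prop))
  simp only [add_sub_cancel] at this
  exact this

lemma hasProd_primaryFactor (hs : 0 < s) (ha : ∀ i, a i ≠ 0)
    (hsum : Summable fun i => ‖a i‖ ^ (-s)) (z : ℂ) :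
    HasProd (fun i => primaryFactor ⌊s⌋₊ (z / a i)) (canonicalProduct s a z) :=
  (hasProdLocallyUniformlyOn_primaryFactor hs ha hsum (‖z‖ + 1)).hasProd (by simp)

lemma differentiable_canonicalProduct (hs : 0 < s) (ha : ∀ i, a i ≠ 0)
    (hsum : Summable fun i => ‖a i‖ ^ (-s)) : Differentiable ℂ (canonicalProduct s a) := by
  intro z
  have hd := differentiable_primaryFactor ⌊s⌋₊
  have h1 := (hasProdLocallyUniformlyOn_iff_tendstoLocallyUniformlyOn.1
    (hasProdLocallyUniformlyOn_primaryFactor hs ha hsum (‖z‖ + 1))).differentiableOn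
    (Eventually.of_forall fun T => Differentiable.differentiableOn (by fun_prop)) isOpen_ball
  exact h1.differentiableAt (isOpen_ball.mem_nhds (by simp))

lemma expGrowth_canonicalProduct (hs : 0 < s) (ha : ∀ i, a i ≠ 0)
    (hsum : Summable fun i => ‖a i‖ ^ (-s)) : ExpGrowth s (canonicalProduct s a) := by
  obtain ⟨C, hC, hCE⟩ := exists_norm_primaryFactor_le hs
  have hS : 0 ≤ ∑' i, ‖a i‖ ^ (-s) := tsum_nonneg fun i => by positivity
  refine ⟨C * ∑' i, ‖a i‖ ^ (-s), by positivity, fun z => ?_⟩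
  refine le_of_tendsto' (hasProd_primaryFactor hs ha hsum z).norm fun T => ?_
  calc ∏ i ∈ T, ‖primaryFactor ⌊s⌋₊ (z / a i)‖
      ≤ ∏ i ∈ T, Real.exp (C * ‖z‖ ^ s * ‖a i‖ ^ (-s)) := by
        refine Finset.prod_le_prod (fun _ _ => norm_nonneg _) fun i _ => (hCE _).trans (le_of_eq ?_)
        rw [norm_div, Real.div_rpow (norm_nonneg _) (norm_nonneg _),
          Real.rpow_neg (norm_nonneg _), div_eq_mul_inv, mul_assoc]
    _ = Real.exp (C * ‖z‖ ^ s * ∑ i ∈ T, ‖a i‖ ^ (-s)) := by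
        rw [← Real.exp_sum, Finset.mul_sum]
    _ ≤ Real.exp (C * (∑' i, ‖a i‖ ^ (-s)) * (1 + ‖z‖) ^ s) := by
        have h1 := hsum.sum_le_tsum T fun i _ => by positivity
        have h2 : ‖z‖ ^ s ≤ (1 + ‖z‖) ^ s := by gcongr; linarith
        rw [mul_right_comm]
        gcongr

lemma canonicalProduct_ne_zero (hs : 0 < s) (ha : ∀ i, a i ≠ 0)
    (hsum : Summable fun i => ‖a i‖ ^ (-s)) {z : ℂ} (hz : ∀ i, a i ≠ z) :
    canonicalProduct s a z ≠ 0 := by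
  have h1 : Summable fun i => ‖primaryFactor ⌊s⌋₊ (z / a i) - 1‖ := by
    refine (hsum.mul_left (4 * (‖z‖ + 1) ^ s)).of_norm_bounded_eventually ?_
    filter_upwards [eventually_cofinite_norm_primaryFactor_sub_one_le hs ha hsum (‖z‖ + 1)]
      with i hi
    rw [norm_norm]
    exact hi z (by simp)
  have h2 := tprod_one_add_ne_zero_of_summable (f := fun i => primaryFactor ⌊s⌋₊ (z / a i) - 1)
    (fun i => ?_) h1
  · simp only [add_sub_cancel] at h2
    exact h2
  · rw [add_sub_cancel]
    refine primaryFactor_ne_zero fun h => hz i ?_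
    rw [div_eq_one_iff_eq (ha i)] at h
    exact h.symm

lemma analyticOrderAt_canonicalProduct (hs : 0 < s) (ha : ∀ i, a i ≠ 0)
    (hsum : Summable fun i => ‖a i‖ ^ (-s)) (z₀ : ℂ) :
    analyticOrderAt (canonicalProduct s a) z₀ = Nat.card {i // a i = z₀} := by
  set S : Set ι := {i | a i = z₀} with hS
  have hfin : S.Finite := by
    have h := eventually_cofinite_le_norm hs ha hsum (‖z₀‖ + 1)
    refine (eventually_cofinite.1 h).subset fun i hi => ?_
    simp only [hS, Set.mem_ofPred_eq] at hi ⊢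
    rw [hi]; linarith
  have : Fintype S := hfin.fintype
  set b : (Sᶜ : Set ι) → ℂ := fun i => a i with hb
  have hb0 : ∀ i, b i ≠ 0 := fun i => ha i
  have hbsum : Summable fun i => ‖b i‖ ^ (-s) := hsum.subtype _
  have hprod : ∀ z, canonicalProduct s a z
      = primaryFactor ⌊s⌋₊ (z / z₀) ^ Nat.card S * canonicalProduct s b z := by
    intro z
    refine (hasProd_primaryFactor hs ha hsum z).unique (HasProd.mul_compl (s := S) ?_
      (hasProd_primaryFactor hs hb0 hbsum z))
    convert! hasProd_fintype ((fun i => primaryFactor ⌊s⌋₊ (z / a i)) ∘ (Subtype.val : S → ι))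
      using 1
    rw [Finset.prod_congr rfl (g := fun _ => primaryFactor ⌊s⌋₊ (z / z₀))
      (fun i _ => by simp only [Function.comp_apply]; rw [i.2]), Finset.prod_const,
      Finset.card_univ, Nat.card_eq_fintype_card]
  have hda := differentiable_canonicalProduct hs ha hsum
  have hdb := differentiable_canonicalProduct hs hb0 hbsum
  have hbne : canonicalProduct s b z₀ ≠ 0 :=
    canonicalProduct_ne_zero hs hb0 hbsum fun i hi => i.2 hi
  change _ = ((Nat.card S : ℕ) : ℕ∞)
  rcases Nat.eq_zero_or_pos (Nat.card S) with h0 | h0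
  · rw [h0, Nat.cast_zero, (hda.analyticAt z₀).analyticOrderAt_eq_zero, hprod, h0, pow_zero,
      one_mul]
    exact hbne
  · have hz₀ : z₀ ≠ 0 := by
      obtain ⟨⟨i, hi⟩⟩ := (Nat.card_pos_iff.1 h0).1
      rw [← hi]; exact ha i
    have hL := differentiable_logTaylor (⌊s⌋₊ + 1)
    rw [(hda.analyticAt z₀).analyticOrderAt_eq_natCast]
    refine ⟨fun z => (-z₀⁻¹ * Complex.exp (-Complex.logTaylor (⌊s⌋₊ + 1) (-(z / z₀)))) ^ Nat.card S
      * canonicalProduct s b z, Differentiable.analyticAt (by fun_prop) _, ?_,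
      Eventually.of_forall fun z => ?_⟩
    · exact mul_ne_zero (pow_ne_zero _ (mul_ne_zero (neg_ne_zero.2 (inv_ne_zero hz₀))
        (Complex.exp_ne_zero _))) hbne
    · rw [hprod, smul_eq_mul, ← mul_assoc, ← mul_pow, primaryFactor]
      congr 2
      rw [← mul_assoc]
      congr 1
      field_simp
      ring

end CanonicalProduct

/-- Convergence of `∑ ‖a i‖ ^ (-s)` from a bound on the counting function. -/
lemma summable_norm_rpow_neg_of_card_le {ι : Type*} {a : ι → ℂ} {s t K : ℝ} (hs : 0 < s)
    (hts : t < s) (hfin : ∀ r, {i | ‖a i‖ ≤ r}.Finite)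
    (hcard : ∀ r, 1 ≤ r → ({i | ‖a i‖ ≤ r}.ncard : ℝ) ≤ K * r ^ t) :
    Summable fun i => ‖a i‖ ^ (-s) := by
  have hex : ∀ i, ∃ j : ℕ, ‖a i‖ ≤ 2 ^ j := fun i =>
    (pow_unbounded_of_one_lt ‖a i‖ one_lt_two).imp fun _ h => h.le
  classical
  set N : ι → ℕ := fun i => Nat.find (hex i) with hN
  have hNle : ∀ i, ‖a i‖ ≤ 2 ^ N i := fun i => Nat.find_spec (hex i)
  have hNlt : ∀ i, 1 < ‖a i‖ → (2 : ℝ) ^ N i / 2 < ‖a i‖ := by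
    intro i hi
    have h0 : N i ≠ 0 := fun h => by
      have := hNle i
      rw [h, pow_zero] at this; linarith
    obtain ⟨k, hk⟩ := Nat.exists_eq_succ_of_ne_zero h0
    have := Nat.find_min (hex i) (m := k) (by change k < N i; omega)
    rw [hk, pow_succ]
    linarith [not_le.1 this]
  have hmain : Summable fun i => 2 ^ s * ((2 : ℝ) ^ (-s)) ^ N i := by
    refine Summable.mul_left _ ?_
    rw [← (Equiv.sigmaFiberEquiv N).summable_iff, summable_sigma_of_nonneg
      (fun _ => by simp only [Function.comp_apply]; positivity)]
    have hf : ∀ j, {i | N i = j}.Finite := fun j => (hfin (2 ^ j)).subset fun i hi => by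
      have := hNle i
      rwa [show N i = j from hi] at this
    have hfi : ∀ j, Finite {i // N i = j} := fun j => (hf j).to_subtype
    refine ⟨fun j => Summable.of_finite, ?_⟩
    have hgeo : Summable fun j : ℕ => K * ((2 : ℝ) ^ (t - s)) ^ j :=
      (summable_geometric_of_lt_one (by positivity)
        (Real.rpow_lt_one_of_one_lt_of_neg one_lt_two (by linarith))).mul_left K
    refine Summable.of_nonneg_of_le (fun j => tsum_nonneg fun _ => ?_) (fun j => ?_) hgeo
    · simp only [Function.comp_apply]; positivity
    · have h1 : ∀ x : {i // N i = j}, ((fun i => ((2 : ℝ) ^ (-s)) ^ N i) ∘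
          (Equiv.sigmaFiberEquiv N)) ⟨j, x⟩ = ((2 : ℝ) ^ (-s)) ^ j := fun x => by
        simp [Equiv.sigmaFiberEquiv, x.2]
      rw [tsum_congr h1, tsum_const, nsmul_eq_mul]
      have h2 : (Nat.card {i // N i = j} : ℝ) ≤ K * ((2 : ℝ) ^ j) ^ t := by
        refine le_trans ?_ (hcard (2 ^ j) (one_le_pow₀ one_le_two))
        refine Nat.cast_le.2 (Set.ncard_le_ncard (s := {i | N i = j}) (fun i hi => ?_)
          (hfin (2 ^ j)))
        have := hNle i
        rwa [show N i = j from hi] at this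
      calc _ ≤ K * ((2 : ℝ) ^ j) ^ t * ((2 : ℝ) ^ (-s)) ^ j := by gcongr
        _ = _ := by
          rw [← Real.rpow_natCast, ← Real.rpow_mul two_pos.le, mul_comm (j : ℝ) t,
            Real.rpow_mul two_pos.le, Real.rpow_natCast, mul_assoc, ← mul_pow,
            ← Real.rpow_add two_pos, sub_eq_add_neg]
  refine hmain.of_norm_bounded_eventually ?_
  filter_upwards [eventually_cofinite.2 ((hfin 1).subset fun i hi => not_lt.1 hi :
    {i | ¬ 1 < ‖a i‖}.Finite)] with i hi
  rw [Real.norm_of_nonneg (by positivity)]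
  calc ‖a i‖ ^ (-s) ≤ ((2 : ℝ) ^ N i / 2) ^ (-s) :=
        Real.rpow_le_rpow_of_nonpos (by positivity) (hNlt i hi).le (by linarith)
    _ = _ := by
      rw [Real.div_rpow (by positivity) two_pos.le, Real.rpow_neg two_pos.le,
        div_inv_eq_mul, mul_comm, ← Real.rpow_natCast, ← Real.rpow_mul two_pos.le,
        mul_comm (N i : ℝ), Real.rpow_mul two_pos.le, Real.rpow_natCast, Real.rpow_neg two_pos.le]

/-- Two entire functions with the same zeros differ by an exponential factor. -/
lemma exists_eq_mul_exp_of_analyticOrderAt_eq {f H : ℂ → ℂ} (hf : Differentiable ℂ f)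
    (hH : Differentiable ℂ H) (htop : ∀ z, analyticOrderAt H z ≠ ⊤)
    (hord : ∀ z, analyticOrderAt f z = analyticOrderAt H z) :
    ∃ g : ℂ → ℂ, Differentiable ℂ g ∧ ∀ z, f z = H z * Complex.exp (g z) := by
  have hmf : ∀ z, MeromorphicAt f z := fun z => (hf.analyticAt z).meromorphicAt
  have hmH : ∀ z, MeromorphicAt H z := fun z => (hH.analyticAt z).meromorphicAt
  have hm : MeromorphicOn (f / H) Set.univ := fun z _ => (hmf z).div (hmH z)
  set u := toMeromorphicNFOn (f / H) Set.univ with hu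
  have hNF : ∀ z, MeromorphicNFAt u z := fun z =>
    meromorphicNFOn_toMeromorphicNFOn (f / H) Set.univ (Set.mem_univ z)
  have hzero : ∀ z, meromorphicOrderAt u z = 0 := by
    intro z
    rw [hu, meromorphicOrderAt_toMeromorphicNFOn hm (Set.mem_univ z),
      meromorphicOrderAt_div (hmf z) (hmH z), (hf.analyticAt z).meromorphicOrderAt_eq,
      (hH.analyticAt z).meromorphicOrderAt_eq, hord]
    obtain ⟨n, hn⟩ := ENat.ne_top_iff_exists.1 (htop z)
    rw [← hn, ENat.map_natCast, ← WithTop.LinearOrderedAddCommGroup.coe_sub, sub_self]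
    rfl
  have hua : ∀ z, AnalyticAt ℂ u z := fun z =>
    (hNF z).meromorphicOrderAt_nonneg_iff_analyticAt.1 (hzero z).ge
  have hune : ∀ z, u z ≠ 0 := fun z => (hNF z).meromorphicOrderAt_eq_zero_iff.1 (hzero z)
  have hud : Differentiable ℂ u := fun z => (hua z).differentiableAt
  have hfu : ∀ z, f z = H z * u z := by
    intro z
    have h1 : f =ᶠ[nhdsWithin z {z}ᶜ] fun x => H x * u x := by
      have h2 : ∀ᶠ x in nhdsWithin z {z}ᶜ, H x ≠ 0 :=
        (hH.analyticAt z).eventually_eq_zero_or_eventually_ne_zero.resolve_left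
          fun h => htop z (analyticOrderAt_eq_top.2 h)
      filter_upwards [h2, hm.toMeromorphicNFOn_eq_self_on_nhdsNE (Set.mem_univ z)] with x hx hx'
      rw [← hu] at hx'
      rw [hx', Pi.div_apply, mul_div_cancel₀ _ hx]
    exact ((ContinuousAt.eventuallyEq_nhds_iff_eventuallyEq_nhdsNE hf.continuous.continuousAt
      (hH.mul hud).continuous.continuousAt).1 h1).eq_of_nhds
  obtain ⟨g, hg0, hg⟩ := (Differentiable.isExactOn_univ (f := fun z => deriv u z / u z)
    (Differentiable.div (fun z => (hua z).deriv.differentiableAt) hud hune)).with_val_at 0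
    (Complex.log (u 0))
  have hg' : ∀ z, HasDerivAt g (deriv u z / u z) z := fun z => hg z (Set.mem_univ z)
  have hgd : Differentiable ℂ g := fun z => (hg' z).differentiableAt
  refine ⟨g, hgd, fun z => ?_⟩
  have hconst : ∀ x, HasDerivAt (fun x => u x * Complex.exp (-g x)) 0 x := by
    intro x
    convert! (hud x).hasDerivAt.mul ((hg' x).neg.cexp) using 1
    field_simp [hune x]
    ring
  have h1 := is_const_of_deriv_eq_zero (fun x => (hconst x).differentiableAt)
    (fun x => (hconst x).deriv) z 0
  rw [hg0, Complex.exp_neg, Complex.exp_neg, Complex.exp_log (hune 0),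
    mul_inv_cancel₀ (hune 0)] at h1
  rw [hfu, ← (mul_inv_eq_one₀ (Complex.exp_ne_zero _)).1 h1]

section ZeroCounting

variable {f : ℂ → ℂ}

lemma analyticOrderAt_eq_zeroMult (hf : Differentiable ℂ f) {z₀ : ℂ} (hz₀ : f z₀ ≠ 0) (z : ℂ) :
    analyticOrderAt f z = zeroMult f z := by
  have htop : analyticOrderAt f z ≠ ⊤ := by
    intro h
    have h1 := AnalyticOnNhd.eq_of_eventuallyEq (f := f) (g := fun _ => 0)
      (fun z _ => hf.analyticAt z) (fun z _ => analyticAt_const) (analyticOrderAt_eq_top.1 h)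
    exact hz₀ (congrFun h1 z₀)
  obtain ⟨n, hn⟩ := ENat.ne_top_iff_exists.1 htop
  have h1 := (analyticOrderAt_eq_nat_iff_iteratedDeriv_eq_zero (hf.analyticAt z)).1 hn.symm
  have h2 : zeroMult f z = n :=
    le_antisymm (Nat.sInf_le h1.2)
      (le_csInf ⟨n, h1.2⟩ fun k hk => not_lt.1 fun hlt => hk (h1.1 k hlt))
  rw [← hn, h2]

lemma eq_zero_of_zeroMult_ne_zero {z : ℂ} (h : zeroMult f z ≠ 0) : f z = 0 := by
  by_contra hne
  exact h (Nat.le_zero.1 (Nat.sInf_le (by simpa using hne)))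

lemma finite_closedBall_inter_support_zeroMult (hf : Differentiable ℂ f) {z₀ : ℂ}
    (hz₀ : f z₀ ≠ 0) (r : ℝ) : (closedBall (0 : ℂ) r ∩ (zeroMult f).support).Finite := by
  have h1 : f ⁻¹' {0}ᶜ ∈ codiscrete ℂ :=
    AnalyticOnNhd.preimage_zero_mem_codiscrete (fun z _ => hf.analyticAt z) hz₀
  have h2 := (isCompact_closedBall (0 : ℂ) r).finite_sdiff_of_mem_codiscreteWithin
    (Filter.codiscreteWithin_mono (Set.subset_univ _) h1)
  exact h2.subset fun z hz => ⟨hz.1, fun h => h (eq_zero_of_zeroMult_ne_zero hz.2)⟩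

/-- The nonzero zeros of `f`, repeated according to multiplicity. -/
abbrev ZeroIndex (f : ℂ → ℂ) : Type := Σ z : {z : ℂ // z ≠ 0}, Fin (zeroMult f z)

lemma finite_ncard_zeroIndex_le (hf : Differentiable ℂ f) {z₀ : ℂ} (hz₀ : f z₀ ≠ 0) (r : ℝ) :
    {i : ZeroIndex f | ‖(i.1 : ℂ)‖ ≤ r}.Finite ∧
      {i : ZeroIndex f | ‖(i.1 : ℂ)‖ ≤ r}.ncard ≤ zeroCount f r := by
  classical
  have hfin := finite_closedBall_inter_support_zeroMult hf hz₀ r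
  set T : Finset {z : ℂ // z ≠ 0} := hfin.toFinset.subtype (fun z => z ≠ 0) with hT
  have hsub : {i : ZeroIndex f | ‖(i.1 : ℂ)‖ ≤ r} ⊆
      ((T.sigma fun z => (Finset.univ : Finset (Fin (zeroMult f z)))) : Finset (ZeroIndex f)) := by
    rintro ⟨z, k⟩ hz
    have hk : zeroMult f z ≠ 0 := fun h => by
      have := k.isLt
      omega
    simp only [Finset.coe_sigma, Set.mem_sigma_iff, hT, Finset.mem_coe, Finset.mem_subtype,
      Set.Finite.mem_toFinset, Finset.mem_univ, and_true]
    exact ⟨by simpa using hz, hk⟩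
  refine ⟨(Finset.finite_toSet _).subset hsub, ?_⟩
  calc _ ≤ _ := Set.ncard_le_ncard hsub (Finset.finite_toSet _)
    _ = ∑ z ∈ T, zeroMult f z := by
      rw [Set.ncard_coe_finset, Finset.card_sigma]
      simp
    _ = ∑ z ∈ hfin.toFinset with z ≠ 0, zeroMult f z := by
      rw [hT, Finset.sum_subtype_eq_sum_filter]
    _ ≤ ∑ z ∈ hfin.toFinset, zeroMult f z :=
      Finset.sum_le_sum_of_subset (Finset.filter_subset _ _)
    _ = zeroCount f r := (finsum_mem_eq_sum _ hfin).symm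

lemma card_zeroIndex_eq {z₀ : ℂ} (hz₀ : z₀ ≠ 0) :
    Nat.card {i : ZeroIndex f // (i.1 : ℂ) = z₀} = zeroMult f z₀ := by
  rw [← Nat.card_fin (zeroMult f z₀)]
  refine (Nat.card_congr ⟨fun k => ⟨⟨⟨z₀, hz₀⟩, k⟩, rfl⟩, fun i => Fin.cast (by rw [i.2]) i.1.2,
    fun k => rfl, ?_⟩).symm
  rintro ⟨⟨⟨z, hz⟩, k⟩, rfl⟩
  rfl

/-- Hadamard-type factorization of an entire function with few zeros. -/
lemma exists_hadamard_factorization (hf : Differentiable ℂ f) {z₀ : ℂ} (hz₀ : f z₀ ≠ 0)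
    {s t K : ℝ} (hs : 0 < s) (hts : t < s)
    (hcount : ∀ r, 1 ≤ r → (zeroCount f r : ℝ) ≤ K * r ^ t) :
    ∃ H g : ℂ → ℂ, Differentiable ℂ H ∧ ExpGrowth s H ∧ Differentiable ℂ g ∧
      ∀ z, f z = H z * Complex.exp (g z) := by
  set a : ZeroIndex f → ℂ := fun i => i.1 with ha
  have ha0 : ∀ i, a i ≠ 0 := fun i => i.1.2
  have hsum : Summable fun i => ‖a i‖ ^ (-s) :=
    summable_norm_rpow_neg_of_card_le hs hts (fun r => (finite_ncard_zeroIndex_le hf hz₀ r).1)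
      fun r hr => le_trans (Nat.cast_le.2 (finite_ncard_zeroIndex_le hf hz₀ r).2) (hcount r hr)
  have hd := differentiable_canonicalProduct hs ha0 hsum
  set H : ℂ → ℂ := fun z => z ^ zeroMult f 0 * canonicalProduct s a z with hH
  have hHd : Differentiable ℂ H := (differentiable_id.pow _).mul hd
  have hHg : ExpGrowth s H :=
    ((ExpGrowth.id hs).pow hs.le _).mul (expGrowth_canonicalProduct hs ha0 hsum)
  have hord : ∀ z, analyticOrderAt H z = zeroMult f z := by
    intro z
    have h1 : analyticOrderAt H z = analyticOrderAt (fun z : ℂ => z ^ zeroMult f 0) z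
        + analyticOrderAt (canonicalProduct s a) z :=
      analyticOrderAt_mul ((differentiable_id.pow _).analyticAt z) (hd.analyticAt z)
    rw [h1, analyticOrderAt_canonicalProduct hs ha0 hsum]
    rcases eq_or_ne z 0 with rfl | hz
    · have h2 : Nat.card {i // a i = 0} = 0 := by
        have : IsEmpty {i // a i = 0} := ⟨fun i => ha0 i.1 i.2⟩
        exact Nat.card_of_isEmpty
      rw [h2, Nat.cast_zero, add_zero,
        AnalyticAt.analyticOrderAt_eq_natCast ((differentiable_id.pow _).analyticAt 0)]
      exact ⟨fun _ => 1, analyticAt_const, one_ne_zero, Eventually.of_forall fun z => by simp⟩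
    · have h2 : analyticOrderAt (fun z : ℂ => z ^ zeroMult f 0) z = 0 :=
        ((differentiable_id.pow _).analyticAt z).analyticOrderAt_eq_zero.2 (pow_ne_zero _ hz)
      rw [card_zeroIndex_eq hz, h2, zero_add]
  obtain ⟨g, hg, hfg⟩ := exists_eq_mul_exp_of_analyticOrderAt_eq hf hHd
    (fun z => by rw [hord]; exact ENat.natCast_ne_top _)
    (fun z => by rw [hord, analyticOrderAt_eq_zeroMult hf hz₀])
  exact ⟨H, g, hHd, hHg, hg, hfg⟩

end ZeroCounting

lemma eventually_le_rpow_of_limsup_lt {u : ℝ → ℝ} {s : ℝ}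
    (h : limsup (fun r : ℝ => ((logPlus (u r) / Real.log r : ℝ) : EReal)) atTop < s) :
    ∀ᶠ r in atTop, u r ≤ r ^ s := by
  filter_upwards [eventually_lt_of_limsup_lt h, eventually_gt_atTop 1] with r hr h1
  have hr0 : 0 < r := one_pos.trans h1
  rcases le_or_gt (u r) 0 with h0 | h0
  · exact h0.trans (Real.rpow_nonneg hr0.le s)
  · rw [EReal.coe_lt_coe_iff, div_lt_iff₀ (Real.log_pos h1)] at hr
    exact (Real.le_rpow_iff_log_le h0 hr0).2 ((le_max_left _ _).trans hr.le)

lemma limsup_le_of_eventually_le_rpow {u : ℝ → ℝ} {s C : ℝ} (hs : 0 ≤ s)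
    (hu : ∀ᶠ r in atTop, 0 ≤ u r ∧ u r ≤ C * r ^ s) :
    limsup (fun r : ℝ => ((logPlus (u r) / Real.log r : ℝ) : EReal)) atTop ≤ s := by
  by_contra! h
  obtain ⟨x, hsx, hx⟩ := EReal.lt_iff_exists_real_btwn.1 h
  rw [EReal.coe_lt_coe_iff] at hsx
  refine hx.not_ge (limsup_le_of_le (h := ?_))
  have hC := (isLittleO_rpow_rpow_atTop_of_lt hsx).def (c := (|C| + 1)⁻¹) (by positivity)
  filter_upwards [hu, hC, eventually_gt_atTop 1] with r ⟨hu0, hur⟩ hCr h1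
  have hr0 : 0 < r := one_pos.trans h1
  rw [EReal.coe_le_coe_iff, div_le_iff₀ (Real.log_pos h1)]
  refine max_le ?_ (mul_nonneg (hs.trans hsx.le) (Real.log_pos h1).le)
  rcases hu0.eq_or_lt with h0 | h0
  · rw [← h0, Real.log_zero]
    exact mul_nonneg (hs.trans hsx.le) (Real.log_pos h1).le
  · rw [← Real.le_rpow_iff_log_le h0 hr0]
    rw [Real.norm_of_nonneg (Real.rpow_nonneg hr0.le _),
      Real.norm_of_nonneg (Real.rpow_nonneg hr0.le _), inv_mul_eq_div,
      le_div_iff₀ (by positivity)] at hCr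
    have h2 : 0 ≤ r ^ s := Real.rpow_nonneg hr0.le _
    nlinarith [mul_le_mul_of_nonneg_right (le_abs_self C) h2]

lemma nevCharEntire_eq_circleAverage (f : ℂ → ℂ) (r : ℝ) :
    nevCharEntire f r = Real.circleAverage (fun z => Real.posLog ‖f z‖) 0 r := by
  rw [Real.circleAverage_def, nevCharEntire, smul_eq_mul]
  simp only [logPlus, Real.posLog, circleMap_zero, max_comm]

lemma nevCharEntire_nonneg (f : ℂ → ℂ) (r : ℝ) : 0 ≤ nevCharEntire f r :=
  mul_nonneg (by positivity) (intervalIntegral.integral_nonneg (by positivity)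
    fun _ _ => le_max_right _ _)

lemma growthOrderEntire_le {f : ℂ → ℂ} {s : ℝ} (hs : 0 ≤ s) (hf : Differentiable ℂ f)
    (hfg : ExpGrowth s f) : growthOrderEntire f ≤ s := by
  obtain ⟨C, -, hC⟩ := hfg.exists_circleAverage_posLog_le hs hf
  refine limsup_le_of_eventually_le_rpow hs (C := C) ?_
  filter_upwards [eventually_ge_atTop 1] with r hr
  exact ⟨nevCharEntire_nonneg f r, (nevCharEntire_eq_circleAverage f r).trans_le (hC r hr)⟩

lemma ExpGrowth.exp_polynomial (P : Polynomial ℂ) :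
    ExpGrowth P.natDegree fun z => Complex.exp (P.eval z) := by
  refine ⟨∑ i ∈ Finset.range (P.natDegree + 1), ‖P.coeff i‖, by positivity, fun z => ?_⟩
  rw [Complex.norm_exp]
  refine Real.exp_le_exp.2 ((Complex.re_le_norm _).trans ?_)
  rw [Polynomial.eval_eq_sum_range, Finset.sum_mul, Real.rpow_natCast]
  refine (norm_sum_le _ _).trans (Finset.sum_le_sum fun i hi => ?_)
  rw [norm_mul, norm_pow]
  gcongr
  calc ‖z‖ ^ i ≤ (1 + ‖z‖) ^ i := by gcongr; linarith
    _ ≤ _ := pow_le_pow_right₀ (by linarith [norm_nonneg z])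
      (Nat.lt_succ_iff.1 (Finset.mem_range.1 hi))

lemma zeroCount_mono {f : ℂ → ℂ} (hf : Differentiable ℂ f) {z₀ : ℂ} (hz₀ : f z₀ ≠ 0) :
    Monotone (zeroCount f) := by
  intro r R hrR
  have h1 := finite_closedBall_inter_support_zeroMult hf hz₀ r
  have h2 := finite_closedBall_inter_support_zeroMult hf hz₀ R
  rw [zeroCount, zeroCount, finsum_mem_eq_sum _ h1, finsum_mem_eq_sum _ h2]
  refine Finset.sum_le_sum_of_subset (Set.Finite.toFinset_subset_toFinset.2 ?_)
  exact Set.inter_subset_inter_left _ (closedBall_subset_closedBall hrR)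

lemma zeroExponent_nonneg (f : ℂ → ℂ) : 0 ≤ zeroExponent f := by
  refine le_limsup_of_frequently_le (Eventually.frequently ?_)
  filter_upwards [eventually_ge_atTop 1] with r hr
  exact_mod_cast div_nonneg (le_max_right _ _) (Real.log_nonneg hr)

/-- An entire function of finite order with few zeros is of the form `H e^P`, where `P` is a
polynomial whose degree is the order and `H` has smaller growth. -/
lemma exists_eq_mul_exp_polynomial {f : ℂ → ℂ} (hf : Differentiable ℂ f) {z₀ : ℂ}
    (hz₀ : f z₀ ≠ 0) (hord : growthOrderEntire f < ⊤)
    (hlr : zeroExponent f < growthOrderEntire f) :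
    ∃ (s : ℝ) (H : ℂ → ℂ) (P : Polynomial ℂ), 0 < s ∧ s < P.natDegree ∧ Differentiable ℂ H ∧
      ExpGrowth s H ∧ (∀ z, f z = H z * Complex.exp (P.eval z)) ∧
      growthOrderEntire f = ((P.natDegree : ℝ) : EReal) := by
  obtain ⟨t, hlt, htr⟩ := EReal.lt_iff_exists_real_btwn.1 hlr
  obtain ⟨s, hts, hsr⟩ := EReal.lt_iff_exists_real_btwn.1 htr
  rw [EReal.coe_lt_coe_iff] at hts
  have ht0 : 0 < t := by exact_mod_cast (zeroExponent_nonneg f).trans_lt hlt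
  have hs0 : 0 < s := ht0.trans hts
  obtain ⟨R, hR⟩ := eventually_atTop.1
    (eventually_le_rpow_of_limsup_lt (u := fun r => zeroCount f r) hlt)
  have hcount : ∀ r, 1 ≤ r → (zeroCount f r : ℝ) ≤ (1 + zeroCount f R) * r ^ t := by
    intro r hr
    have h1 : 1 ≤ r ^ t := Real.one_le_rpow hr ht0.le
    have h2 : (0 : ℝ) ≤ zeroCount f R := Nat.cast_nonneg _
    rcases le_total R r with h | h
    · nlinarith [hR r h]
    · have : (zeroCount f r : ℝ) ≤ zeroCount f R := by exact_mod_cast zeroCount_mono hf hz₀ h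
      nlinarith
  obtain ⟨H, g, hH, hHg, hg, hfH⟩ := exists_hadamard_factorization hf hz₀ hs0 hts hcount
  have hH0 : ¬ ∀ z, H z = 0 := fun h => hz₀ (by rw [hfH, h, zero_mul])
  obtain ⟨ρ, hρ⟩ : ∃ ρ : ℝ, growthOrderEntire f = ρ :=
    ⟨_, (EReal.coe_toReal hord.ne (ne_bot_of_gt hsr)).symm⟩
  rw [hρ, EReal.coe_lt_coe_iff] at hsr
  have hρ0 : 0 ≤ ρ := (hs0.trans hsr).le
  obtain ⟨τ, hρτ, hτ⟩ := exists_between (Nat.lt_floor_add_one ρ)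
  have hτ0 : 0 ≤ τ := hρ0.trans hρτ.le
  have hgrowth : ∀ᶠ r in atTop,
      Real.circleAverage (fun z => Real.posLog ‖f z‖) 0 r ≤ 1 * r ^ τ := by
    have h1 : growthOrderEntire f < τ := by rw [hρ]; exact_mod_cast hρτ
    filter_upwards [eventually_le_rpow_of_limsup_lt h1] with r hr
    rwa [one_mul, ← nevCharEntire_eq_circleAverage]
  obtain ⟨P, hP, hgP⟩ := exists_polynomial_of_eq_mul_exp hf hH hg hfH hτ0
    (hHg.mono (hsr.trans hρτ).le) hH0 hgrowth
  have hfP : ∀ z, f z = H z * Complex.exp (P.eval z) := fun z => by rw [hfH, hgP]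
  have hPρ : (P.natDegree : ℝ) ≤ ρ := by
    have h1 : P.natDegree < ⌊ρ⌋₊ + 1 := by exact_mod_cast hP.trans_lt hτ
    exact (Nat.le_floor_iff hρ0).1 (Nat.lt_succ_iff.1 h1)
  have hρP : ρ ≤ max s P.natDegree := by
    have h1 : ExpGrowth (max s P.natDegree) f := by
      rw [funext hfP]
      exact (hHg.mono (le_max_left _ _)).mul ((ExpGrowth.exp_polynomial P).mono (le_max_right _ _))
    have h2 := growthOrderEntire_le (hs0.le.trans (le_max_left _ _)) hf h1
    rwa [hρ, EReal.coe_le_coe_iff] at h2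
  have hρP' : ρ = P.natDegree :=
    le_antisymm ((le_max_iff.1 hρP).resolve_left hsr.not_ge) hPρ
  exact ⟨s, H, P, hs0, hρP' ▸ hsr, hH, hHg, hfP, by rw [hρ, hρP']⟩

theorem statement4 (n : ℕ) (hn : n = 2) (c w p₁ p₂ α₁ α₂ : ℂ)
    (hw : w ≠ 0) (hc : c ≠ 0) (hp₁ : p₁ ≠ 0) (hp₂ : p₂ ≠ 0) (hα₁ : α₁ ≠ 0) (hα₂ : α₂ ≠ 0)
    (hα : α₁ ≠ α₂) (q Q : Polynomial ℂ) (hq : q ≠ 0) (hQ : 0 < Q.natDegree)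
    (f : ℂ → ℂ) (hf : Differentiable ℂ f)
    (htrans : TranscendentalEntire f) (hord : growthOrderEntire f < ⊤)
    (hlr : zeroExponent f < growthOrderEntire f)
    (heq : ∀ z : ℂ, f z ^ n + w * f z ^ (n - 1) * deriv f z
        + q.eval z * Complex.exp (Q.eval z) * f (z + c)
      = p₁ * Complex.exp (α₁ * z) + p₂ * Complex.exp (α₂ * z)) :
    growthOrderEntire f = (1 : EReal) ∧ Q.natDegree = 1 := by
  subst hn
  have hz₀ : ∃ z₀, f z₀ ≠ 0 := by
    by_contra! h
    exact htrans ⟨0, fun z => by rw [h, Polynomial.eval_zero]⟩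
  obtain ⟨z₀, hz₀⟩ := hz₀
  obtain ⟨s, H, P, hs, hsP, hH, hHg, hfH, hρ⟩ := exists_eq_mul_exp_polynomial hf hz₀ hord hlr
  obtain ⟨hP1, hQ1⟩ := natDegree_le_one_of_equation hw hp₁ hα hq hH hHg hs hsP hfH
    (fun h => hz₀ (by rw [hfH, h, zero_mul])) (by simpa using heq)
  have hP0 : 0 < P.natDegree := by exact_mod_cast hs.trans hsP
  refine ⟨?_, by omega⟩
  rw [hρ, show P.natDegree = 1 by omega, Nat.cast_one, EReal.coe_one]
end
end

section
/- Let n ≥ 1 be an integer and suppose f(z) = e^{α(z)}, with α a nonconstant polynomial, is a solution of the differential-difference equation f(z)^n + w·f(z)^{n-1}·f'(z) + q(z)e^{Q(z)}·f(z+c) = p₁e^{α₁z} + p₂e^{α₂z}. Then either f(z) = e^{(α₂z/n) + β} and Q(z) = (α₁ − α₂/n)z + b, or f(z) = e^{(α₁z/n) + β} and Q(z) = (α₂ − α₁/n)z + b, where β and b are complex constants. -/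
noncomputable section

open Polynomial in
/-- The derivative of `P * exp h` is `twistedDerivative h P * exp h`. -/
def twistedDerivative (h P : ℂ[X]) : ℂ[X] := derivative P + derivative h * P

open Polynomial in
theorem hasDerivAt_eval_mul_exp (h P : ℂ[X]) (z : ℂ) :
    HasDerivAt (fun z => P.eval z * Complex.exp (h.eval z))
      ((twistedDerivative h P).eval z * Complex.exp (h.eval z)) z := by
  refine ((P.hasDerivAt z).mul (h.hasDerivAt z).cexp).congr_deriv ?_
  simp only [twistedDerivative, eval_add, eval_mul]
  ring

open Polynomial in
theorem eq_zero_of_twistedDerivative_eq_zero {h P : ℂ[X]} (hh : derivative h ≠ 0)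
    (hP : twistedDerivative h P = 0) : P = 0 := by
  by_contra hne
  have hlt := degree_derivative_lt hne
  rw [twistedDerivative, add_eq_zero_iff_eq_neg] at hP
  rw [hP, degree_neg, degree_mul, degree_eq_natDegree hh, degree_eq_natDegree hne] at hlt
  norm_cast at hlt
  omega

open Polynomial in
theorem eq_zero_of_iterate_twistedDerivative_eq_zero {h P : ℂ[X]} (hh : derivative h ≠ 0)
    (k : ℕ) (hP : (twistedDerivative h)^[k] P = 0) : P = 0 := by
  induction k with
  | zero => exact hP
  | succ k ih =>
    rw [Function.iterate_succ_apply'] at hP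
    exact ih (eq_zero_of_twistedDerivative_eq_zero hh hP)

open Polynomial in
theorem sum_iterate_twistedDerivative_eq_zero {ι : Type*} (s : Finset ι) (g P : ι → ℂ[X])
    (H : ∀ z : ℂ, ∑ i ∈ s, (P i).eval z * Complex.exp ((g i).eval z) = 0) (k : ℕ) :
    ∀ z : ℂ, ∑ i ∈ s, ((twistedDerivative (g i))^[k] (P i)).eval z *
      Complex.exp ((g i).eval z) = 0 := by
  induction k with
  | zero => exact H
  | succ k ih =>
    intro z
    have hd := HasDerivAt.fun_sum fun i (_ : i ∈ s) =>
      hasDerivAt_eval_mul_exp (g i) ((twistedDerivative (g i))^[k] (P i)) z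
    simp only [Function.iterate_succ_apply']
    refine hd.unique ?_
    simp only [ih]
    exact hasDerivAt_const z 0

open Polynomial in
/-- In a vanishing sum of terms `P i * exp (g i)` with polynomial `P i` and `g i`, a term whose
exponent differs from all the others by nonconstant polynomials has coefficient zero. -/
theorem coeff_eq_zero_of_sum_mul_exp_eq_zero {ι : Type*} [DecidableEq ι] (j : ι) (s : Finset ι)
    (hj : j ∉ s) (g P : ι → ℂ[X]) (hg : ∀ i ∈ s, derivative (g i) ≠ derivative (g j))
    (H : ∀ z : ℂ, ∑ i ∈ insert j s, (P i).eval z * Complex.exp ((g i).eval z) = 0) :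
    P j = 0 := by
  induction s using Finset.induction_on generalizing g P with
  | empty =>
    refine Polynomial.funext fun z => ?_
    simpa [Complex.exp_ne_zero] using H z
  | insert a s ha ih =>
    obtain ⟨hja, hjs⟩ : j ≠ a ∧ j ∉ s := by simpa using hj
    have H' : ∀ z : ℂ, ∑ i ∈ insert j (insert a s),
        (P i).eval z * Complex.exp ((g i - g a).eval z) = 0 := fun z => by
      simp only [eval_sub, Complex.exp_sub, ← mul_div_assoc, ← Finset.sum_div, H z, zero_div]
    have hk := sum_iterate_twistedDerivative_eq_zero _ (fun i => g i - g a) P H'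
      ((P a).natDegree + 1)
    have htw : twistedDerivative (g a - g a) = derivative := by
      funext p
      simp [twistedDerivative]
    refine eq_zero_of_iterate_twistedDerivative_eq_zero (h := g j - g a) ?_
      ((P a).natDegree + 1) (ih hjs (fun i => g i - g a)
        (fun i => (twistedDerivative (g i - g a))^[(P a).natDegree + 1] (P i)) ?_ fun z => ?_)
    · rw [derivative_sub, sub_ne_zero]
      exact (hg a (Finset.mem_insert_self a s)).symm
    · intro i hi
      simpa using hg i (Finset.mem_insert_of_mem hi)
    · have hz := hk z
      rw [Finset.insert_comm, Finset.sum_insert (by simp [ha, hja.symm])] at hz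
      simpa only [htw, iterate_derivative_eq_zero (Nat.lt_succ_self _), eval_zero, zero_mul,
        zero_add] using hz

open Polynomial in
theorem exists_eval_eq_of_derivative_eq_C {p : ℂ[X]} {a : ℂ} (hp : derivative p = C a) :
    ∃ b : ℂ, ∀ z, p.eval z = a * z + b := by
  have h : derivative (p - C a * X) = 0 := by simp [hp]
  refine ⟨(p - C a * X).coeff 0, fun z => ?_⟩
  have := congrArg (eval z) (eq_C_of_natDegree_eq_zero (derivative_eq_zero.1 h))
  simp only [eval_sub, eval_mul, eval_C, eval_X] at this
  linear_combination this

open Polynomial in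
theorem exists_linear_of_derivative_eq {n : ℕ} (hn : 1 ≤ n) {c a b : ℂ} {α Q : ℂ[X]}
    (hA : derivative (C (n : ℂ) * α) = C a) (hB : derivative (Q + α.comp (X + C c)) = C b) :
    ∃ β d : ℂ, (∀ z, α.eval z = a * z / n + β) ∧ ∀ z, Q.eval z = (b - a / n) * z + d := by
  have hn0 : (n : ℂ) ≠ 0 := by exact_mod_cast (by omega : n ≠ 0)
  obtain ⟨u, hu⟩ := exists_eval_eq_of_derivative_eq_C hA
  obtain ⟨v, hv⟩ := exists_eval_eq_of_derivative_eq_C hB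
  simp only [eval_mul, eval_add, eval_comp, eval_C, eval_X] at hu hv
  have hα : ∀ z, α.eval z = a * z / n + u / n := fun z => by
    field_simp
    linear_combination hu z
  refine ⟨u / n, v - a * c / n - u / n, hα, fun z => ?_⟩
  linear_combination hv z - hα (z + c)

theorem statement5 (n : ℕ) (hn : 1 ≤ n) (c w p₁ p₂ α₁ α₂ : ℂ)
    (hw : w ≠ 0) (hc : c ≠ 0) (hp₁ : p₁ ≠ 0) (hp₂ : p₂ ≠ 0) (hα₁ : α₁ ≠ 0) (hα₂ : α₂ ≠ 0)
    (hα : α₁ ≠ α₂) (q Q : Polynomial ℂ) (hq : q ≠ 0) (hQ : 0 < Q.natDegree)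
    (α : Polynomial ℂ) (hα' : 0 < α.natDegree) (f : ℂ → ℂ)
    (hfΓ : ∀ z : ℂ, f z = Complex.exp (α.eval z))
    (heq : ∀ z : ℂ, f z ^ n + w * f z ^ (n - 1) * deriv f z
        + q.eval z * Complex.exp (Q.eval z) * f (z + c)
      = p₁ * Complex.exp (α₁ * z) + p₂ * Complex.exp (α₂ * z)) :
    ∃ β b : ℂ,
      ((∀ z : ℂ, f z = Complex.exp (α₂ * z / n + β)) ∧
        (∀ z : ℂ, Q.eval z = (α₁ - α₂ / n) * z + b)) ∨
      ((∀ z : ℂ, f z = Complex.exp (α₁ * z / n + β)) ∧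
        (∀ z : ℂ, Q.eval z = (α₂ - α₁ / n) * z + b)) := by
  let g : Fin 4 → Polynomial ℂ := ![.C (n : ℂ) * α, Q + α.comp (.X + .C c), .C α₁ * .X, .C α₂ * .X]
  let P : Fin 4 → Polynomial ℂ := ![1 + .C w * α.derivative, q, .C (-p₁), .C (-p₂)]
  have hf : f = fun z => Complex.exp (α.eval z) := funext hfΓ
  have H : ∀ z : ℂ, ∑ i, (P i).eval z * Complex.exp ((g i).eval z) = 0 := fun z => by
    have hz := heq z
    have hderiv : deriv f z = Complex.exp (α.eval z) * α.derivative.eval z := by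
      rw [hf]
      exact (α.hasDerivAt z).cexp.deriv
    have hpow : Complex.exp (α.eval z) ^ n
        = Complex.exp (α.eval z) ^ (n - 1) * Complex.exp (α.eval z) := by
      rw [← pow_succ, Nat.sub_add_cancel hn]
    rw [hderiv, hfΓ, hfΓ] at hz
    simp only [Fin.sum_univ_four, g, P, Matrix.cons_val, Polynomial.eval_add,
      Polynomial.eval_mul, Polynomial.eval_C, Polynomial.eval_X, Polynomial.eval_one,
      Polynomial.eval_comp, Complex.exp_add, Complex.exp_nat_mul]
    linear_combination hz + w * α.derivative.eval z * hpow
  have key : ∀ j, P j ≠ 0 → ∃ i, i ≠ j ∧ (g i).derivative = (g j).derivative := fun j hj => by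
    by_contra! hne
    refine hj (coeff_eq_zero_of_sum_mul_exp_eq_zero j (Finset.univ.erase j) (by simp) g P
      (fun i hi => hne i (Finset.ne_of_mem_erase hi)) ?_)
    rwa [Finset.insert_erase (Finset.mem_univ j)]
  have h₁ : (g 0).derivative = .C α₁ ∨ (g 1).derivative = .C α₁ := by
    obtain ⟨i, hi, h⟩ := key 2 (by simpa [P] using hp₁)
    fin_cases i <;> simp_all [g]
  have h₂ : (g 0).derivative = .C α₂ ∨ (g 1).derivative = .C α₂ := by
    obtain ⟨i, hi, h⟩ := key 3 (by simpa [P] using hp₂)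
    fin_cases i <;> simp_all [g]
  have hC : (.C α₁ : Polynomial ℂ) ≠ .C α₂ := fun h => hα (Polynomial.C_injective h)
  have hcases : ((g 0).derivative = .C α₂ ∧ (g 1).derivative = .C α₁) ∨
      ((g 0).derivative = .C α₁ ∧ (g 1).derivative = .C α₂) := by
    grind
  rcases hcases with ⟨hA, hB⟩ | ⟨hA, hB⟩
  · obtain ⟨β, b, hαz, hQz⟩ := exists_linear_of_derivative_eq hn hA hB
    exact ⟨β, b, Or.inl ⟨fun z => by rw [hfΓ, hαz], hQz⟩⟩
  · obtain ⟨β, b, hαz, hQz⟩ := exists_linear_of_derivative_eq hn hA hB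
    exact ⟨β, b, Or.inr ⟨fun z => by rw [hfΓ, hαz], hQz⟩⟩
end
end

section
/- Let n ≥ 3 and k ≥ 0 be integers, c ∈ ℂ, and w, p₁, p₂, α₁, α₂ nonzero complex constants with α₁ ≠ α₂. Suppose f is an entire function on ℂ satisfying f(z)^n + w·f(z)^{n-1}·f'(z) + f^{(k)}(z+c) = p₁e^{α₁z} + p₂e^{α₂z} for all z. Set N(z) = f^{(k)}(z+c) and φ = α₁α₂f³ + (wα₁α₂ − n(α₁+α₂))f²f' + (n − w(α₁+α₂))f²f'' + wf²f''' + (n−1)(n − w(α₁+α₂))f(f')² + w(n−1)(n−2)(f')³ + 3w(n−1)ff'f''. Then f(z)^{n−3}·φ(z) = −(α₁α₂N(z) − (α₁+α₂)N'(z) + N''(z)) for all z ∈ ℂ. -/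
noncomputable section

/-- Every iterated derivative of an entire function has the next one as its derivative. -/
theorem hasDerivAt_iteratedDeriv_of_differentiable {f : ℂ → ℂ} (hf : Differentiable ℂ f)
    (j : ℕ) (z : ℂ) : HasDerivAt (iteratedDeriv j f) (iteratedDeriv (j + 1) f z) z := by
  rw [iteratedDeriv_succ]
  exact ((hf.contDiff (n := j + 1)).differentiable_iteratedDeriv j
    (by exact_mod_cast Nat.lt_succ_self j) z).hasDerivAt

theorem hasDerivAt_const_mul_exp (p a z : ℂ) :
    HasDerivAt (fun z => p * Complex.exp (a * z)) (a * (p * Complex.exp (a * z))) z := by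
  refine ((((hasDerivAt_id z).const_mul a).cexp).const_mul p).congr_deriv ?_
  simp only [id]
  ring

theorem statement7 (n k : ℕ) (hn : 3 ≤ n) (c w p₁ p₂ α₁ α₂ : ℂ)
    (hw : w ≠ 0) (hp₁ : p₁ ≠ 0) (hp₂ : p₂ ≠ 0) (hα₁ : α₁ ≠ 0) (hα₂ : α₂ ≠ 0)
    (hα : α₁ ≠ α₂) (f : ℂ → ℂ) (hf : Differentiable ℂ f)
    (heq : ∀ z : ℂ, f z ^ n + w * f z ^ (n - 1) * deriv f z + iteratedDeriv k f (z + c)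
      = p₁ * Complex.exp (α₁ * z) + p₂ * Complex.exp (α₂ * z)) :
    ∀ z : ℂ,
      f z ^ (n - 3) *
        (α₁ * α₂ * f z ^ 3
          + (w * α₁ * α₂ - n * (α₁ + α₂)) * f z ^ 2 * deriv f z
          + ((n : ℂ) - w * (α₁ + α₂)) * f z ^ 2 * iteratedDeriv 2 f z
          + w * f z ^ 2 * iteratedDeriv 3 f z
          + ((n : ℂ) - 1) * ((n : ℂ) - w * (α₁ + α₂)) * f z * (deriv f z) ^ 2
          + w * ((n : ℂ) - 1) * ((n : ℂ) - 2) * (deriv f z) ^ 3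
          + 3 * w * ((n : ℂ) - 1) * f z * deriv f z * iteratedDeriv 2 f z)
      = -(α₁ * α₂ * iteratedDeriv k f (z + c)
          - (α₁ + α₂) * iteratedDeriv (k + 1) f (z + c)
          + iteratedDeriv (k + 2) f (z + c)) := by
  obtain ⟨m, rfl⟩ := Nat.exists_eq_add_of_le' hn
  have hD := hasDerivAt_iteratedDeriv_of_differentiable hf
  have hf₀ (z : ℂ) : HasDerivAt f (deriv f z) z := (hf z).hasDerivAt
  have hf₁ (z : ℂ) : HasDerivAt (deriv f) (iteratedDeriv 2 f z) z := by
    simpa only [iteratedDeriv_one] using hD 1 z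
  have hN (j : ℕ) (z : ℂ) : HasDerivAt (fun z => iteratedDeriv j f (z + c))
      (iteratedDeriv (j + 1) f (z + c)) z := (hD j (z + c)).comp_add_const z c
  have heq' (z : ℂ) : ((m : ℂ) + 3) * f z ^ (m + 2) * deriv f z
      + w * (((m : ℂ) + 2) * f z ^ (m + 1) * deriv f z ^ 2
        + f z ^ (m + 2) * iteratedDeriv 2 f z) + iteratedDeriv (k + 1) f (z + c)
      = α₁ * (p₁ * Complex.exp (α₁ * z)) + α₂ * (p₂ * Complex.exp (α₂ * z)) := by
    have hl := (((hf₀ z).pow (m + 3)).add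
      ((((hf₀ z).pow (m + 2)).mul (hf₁ z)).const_mul w)).add (hN k z)
    have hr := (hasDerivAt_const_mul_exp p₁ α₁ z).add (hasDerivAt_const_mul_exp p₂ α₂ z)
    have hlr := hl.unique (hr.congr_of_eventuallyEq (.of_forall fun x => by
      simpa [mul_assoc] using heq x))
    simp only [Nat.add_one_sub_one, Pi.pow_apply] at hlr
    push_cast at hlr
    linear_combination hlr
  have heq'' (z : ℂ) : ((m : ℂ) + 3) * (((m : ℂ) + 2) * f z ^ (m + 1) * deriv f z ^ 2
        + f z ^ (m + 2) * iteratedDeriv 2 f z)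
      + w * (((m : ℂ) + 2) * (((m : ℂ) + 1) * f z ^ m * deriv f z ^ 3
          + f z ^ (m + 1) * (2 * deriv f z * iteratedDeriv 2 f z))
        + (((m : ℂ) + 2) * f z ^ (m + 1) * deriv f z * iteratedDeriv 2 f z
          + f z ^ (m + 2) * iteratedDeriv 3 f z)) + iteratedDeriv (k + 2) f (z + c)
      = α₁ * (α₁ * (p₁ * Complex.exp (α₁ * z))) + α₂ * (α₂ * (p₂ * Complex.exp (α₂ * z))) := by
    have hl := (((((hf₀ z).pow (m + 2)).mul (hf₁ z)).const_mul ((m : ℂ) + 3)).add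
      ((((((hf₀ z).pow (m + 1)).mul ((hf₁ z).pow 2)).const_mul ((m : ℂ) + 2)).add
        (((hf₀ z).pow (m + 2)).mul (hD 2 z))).const_mul w)).add (hN (k + 1) z)
    have hr := ((hasDerivAt_const_mul_exp p₁ α₁ z).const_mul α₁).add
      ((hasDerivAt_const_mul_exp p₂ α₂ z).const_mul α₂)
    have hlr := hl.unique (hr.congr_of_eventuallyEq (.of_forall fun x => by
      simpa [mul_assoc] using heq' x))
    simp only [Nat.add_one_sub_one, Pi.pow_apply] at hlr
    push_cast at hlr
    linear_combination hlr
  intro z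
  have h₀ := heq z
  simp only [Nat.add_succ_sub_one, Nat.add_sub_cancel] at h₀ ⊢
  push_cast
  linear_combination α₁ * α₂ * h₀ - (α₁ + α₂) * heq' z + heq'' z
end
end

section
/- Let n ≥ 3 be an integer and w, α₁, α₂ nonzero complex constants. Suppose f is a transcendental entire function on ℂ of finite order satisfying identically α₁α₂f³ + (wα₁α₂ − n(α₁+α₂))f²f' + (n − w(α₁+α₂))f²f'' + wf²f''' + (n−1)(n − w(α₁+α₂))f(f')² + w(n−1)(n−2)(f')³ + 3w(n−1)ff'f'' ≡ 0. Then f has at most finitely many zeros. -/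
open MeasureTheory Filter Metric

noncomputable section

/-- An entire solution of a third-order linear homogeneous ODE with constant coefficients
vanishes identically if its first three derivatives vanish at a point. -/
theorem eq_zero_of_third_order_linear_ode {g : ℂ → ℂ} (hg : Differentiable ℂ g) {a b c z₀ : ℂ}
    (hode : iteratedDeriv 3 g =
      fun z => a * iteratedDeriv 2 g z + b * iteratedDeriv 1 g z + c * g z)
    (h0 : g z₀ = 0) (h1 : iteratedDeriv 1 g z₀ = 0) (h2 : iteratedDeriv 2 g z₀ = 0) (z : ℂ) :
    g z = 0 := by
  have hsmooth : ∀ k l : ℕ, ContDiffAt ℂ k (iteratedDeriv l g) z₀ := fun k l =>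
    (hg.contDiff.iterate_deriv' k l |>.contDiffAt).congr_of_eventuallyEq
      (Eventually.of_forall fun _ => by rw [iteratedDeriv_eq_iterate])
  have hrec : ∀ k : ℕ, iteratedDeriv (k + 3) g z₀ = a * iteratedDeriv (k + 2) g z₀
      + b * iteratedDeriv (k + 1) g z₀ + c * iteratedDeriv k g z₀ := by
    intro k
    have hcomp : ∀ l, iteratedDeriv (k + l) g = iteratedDeriv k (iteratedDeriv l g) := fun l => by
      simp only [iteratedDeriv_eq_iterate, Function.iterate_add_apply]
    have hc : ContDiffAt ℂ k g z₀ := hg.contDiff.contDiffAt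
    rw [hcomp 3, hode, iteratedDeriv_fun_add, iteratedDeriv_fun_add,
      iteratedDeriv_const_mul_field, iteratedDeriv_const_mul_field, iteratedDeriv_const_mul_field,
      ← hcomp 2, ← hcomp 1]
    · exact contDiffAt_const.mul (hsmooth k 2)
    · exact contDiffAt_const.mul (hsmooth k 1)
    · exact (contDiffAt_const.mul (hsmooth k 2)).add (contDiffAt_const.mul (hsmooth k 1))
    · exact contDiffAt_const.mul hc
  have hall : ∀ k : ℕ, iteratedDeriv k g z₀ = 0 ∧ iteratedDeriv (k + 1) g z₀ = 0
      ∧ iteratedDeriv (k + 2) g z₀ = 0 := by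
    intro k
    induction k with
    | zero => exact ⟨by simpa using h0, h1, h2⟩
    | succ k ih =>
      obtain ⟨i0, i1, i2⟩ := ih
      refine ⟨i1, i2, ?_⟩
      have := hrec k
      rw [i0, i1, i2] at this
      simpa using this
  rw [← Complex.taylorSeries_eq_of_entire' z₀ z hg]
  simp [hall]

/-- The first three derivatives of the power `f ^ (m + 3)` of an entire function. -/
theorem iteratedDeriv_pow_add_three {f : ℂ → ℂ} (hf : Differentiable ℂ f) (m : ℕ) :
    (iteratedDeriv 1 (fun z => f z ^ (m + 3)) = fun z => (m + 3) * f z ^ (m + 2) * deriv f z) ∧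
    (iteratedDeriv 2 (fun z => f z ^ (m + 3)) = fun z => (m + 3) * f z ^ (m + 1) *
      ((m + 2) * deriv f z ^ 2 + f z * iteratedDeriv 2 f z)) ∧
    (iteratedDeriv 3 (fun z => f z ^ (m + 3)) = fun z => (m + 3) * f z ^ m *
      ((m + 2) * (m + 1) * deriv f z ^ 3 + 3 * (m + 2) * f z * deriv f z * iteratedDeriv 2 f z
        + f z ^ 2 * iteratedDeriv 3 f z)) := by
  have d0 : ∀ z, HasDerivAt f (deriv f z) z := fun z => (hf z).hasDerivAt
  have d1 : ∀ z, HasDerivAt (deriv f) (iteratedDeriv 2 f z) z := fun z => by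
    rw [iteratedDeriv_succ, iteratedDeriv_one]
    exact (hf.deriv z).hasDerivAt
  have d2 : ∀ z, HasDerivAt (iteratedDeriv 2 f) (iteratedDeriv 3 f z) z := fun z => by
    rw [iteratedDeriv_succ (n := 2), iteratedDeriv_succ, iteratedDeriv_one]
    exact (hf.deriv.deriv z).hasDerivAt
  have e1 : iteratedDeriv 1 (fun z => f z ^ (m + 3)) =
      fun z => (m + 3) * f z ^ (m + 2) * deriv f z := by
    funext z
    rw [iteratedDeriv_one, ((d0 z).fun_pow (m + 3)).deriv]
    push_cast
    rfl
  have e2 : iteratedDeriv 2 (fun z => f z ^ (m + 3)) = fun z => (m + 3) * f z ^ (m + 1) *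
      ((m + 2) * deriv f z ^ 2 + f z * iteratedDeriv 2 f z) := by
    funext z
    rw [iteratedDeriv_succ, e1,
      ((((d0 z).fun_pow (m + 2)).const_mul ((m : ℂ) + 3)).fun_mul (d1 z)).deriv]
    simp only [Nat.add_succ_sub_one]
    push_cast
    ring
  refine ⟨e1, e2, ?_⟩
  funext z
  rw [iteratedDeriv_succ, e2,
    ((((d0 z).fun_pow (m + 1)).const_mul ((m : ℂ) + 3)).fun_mul
      ((((d1 z).fun_pow 2).const_mul ((m : ℂ) + 2)).fun_add ((d0 z).fun_mul (d2 z)))).deriv]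
  simp only [Nat.add_succ_sub_one]
  push_cast
  ring

theorem statement8 (n : ℕ) (hn : 3 ≤ n) (w α₁ α₂ : ℂ)
    (hw : w ≠ 0) (hα₁ : α₁ ≠ 0) (hα₂ : α₂ ≠ 0)
    (f : ℂ → ℂ) (hf : Differentiable ℂ f)
    (htrans : TranscendentalEntire f) (hord : growthOrderEntire f < ⊤)
    (heq : ∀ z : ℂ,
      α₁ * α₂ * f z ^ 3
        + (w * α₁ * α₂ - n * (α₁ + α₂)) * f z ^ 2 * deriv f z
        + ((n : ℂ) - w * (α₁ + α₂)) * f z ^ 2 * iteratedDeriv 2 f z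
        + w * f z ^ 2 * iteratedDeriv 3 f z
        + ((n : ℂ) - 1) * ((n : ℂ) - w * (α₁ + α₂)) * f z * (deriv f z) ^ 2
        + w * ((n : ℂ) - 1) * ((n : ℂ) - 2) * (deriv f z) ^ 3
        + 3 * w * ((n : ℂ) - 1) * f z * deriv f z * iteratedDeriv 2 f z = 0) :
    {z : ℂ | f z = 0}.Finite := by
  obtain ⟨m, rfl⟩ := Nat.exists_eq_add_of_le' hn
  obtain ⟨e1, e2, e3⟩ := iteratedDeriv_pow_add_three hf m
  have hode : iteratedDeriv 3 (fun z => f z ^ (m + 3)) = fun z =>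
      (α₁ + α₂ - (m + 3) / w) * iteratedDeriv 2 (fun z => f z ^ (m + 3)) z
      + ((m + 3) * (α₁ + α₂) / w - α₁ * α₂) * iteratedDeriv 1 (fun z => f z ^ (m + 3)) z
      + (-((m + 3) * (α₁ * α₂) / w)) * f z ^ (m + 3) := by
    rw [e1, e2, e3]
    funext z
    have h := heq z
    push_cast at h
    field_simp
    linear_combination ((m + 3) * f z ^ m) * h
  convert! Set.finite_empty
  refine Set.eq_empty_of_forall_notMem fun z₀ hz₀ => htrans ⟨0, fun z => ?_⟩
  have hz₀ : f z₀ = 0 := hz₀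
  have := eq_zero_of_third_order_linear_ode (hf.fun_pow (m + 3)) hode (z₀ := z₀)
    (by simp [hz₀]) (by simp [e1, hz₀]) (by simp [e2, hz₀]) z
  simpa using eq_zero_of_pow_eq_zero this
end
end

section
/- Let n ≥ 2 be an integer and w, α₁ nonzero complex constants. Suppose f is a transcendental entire function on ℂ satisfying identically α₁f^n + (α₁w − n)f^{n−1}f' − (n−1)w·f^{n−2}(f')² − w·f^{n−1}f'' ≡ 0. Then either f(z) = C·e^{−z/w} for some nonzero constant C, or f(z) = C·e^{α₁z/n} for some nonzero constant C. -/
noncomputable section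

/-- If `u' = a u + b e^{az}` on the complex plane, then `u = (u 0 + b z) e^{az}`. -/
theorem eq_mul_exp_of_hasDerivAt {u : ℂ → ℂ} {a b : ℂ}
    (hu : ∀ z, HasDerivAt u (a * u z + b * Complex.exp (a * z)) z) (z : ℂ) :
    u z = (u 0 + b * z) * Complex.exp (a * z) := by
  have hexp (x : ℂ) : Complex.exp (a * x) * Complex.exp (-(a * x)) = 1 := by
    rw [← Complex.exp_add, add_neg_cancel, Complex.exp_zero]
  have hd (x : ℂ) : HasDerivAt (fun y => u y * Complex.exp (-(a * y)) - b * y) 0 x := by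
    have h := ((hu x).mul ((hasDerivAt_id x).const_mul a).neg.cexp).sub
      ((hasDerivAt_id x).const_mul b)
    refine h.congr_deriv ?_
    simp only [id]
    linear_combination b * hexp x
  have hc := is_const_of_deriv_eq_zero (fun x => (hd x).differentiableAt)
    (fun x => (hd x).deriv) z 0
  simp only [mul_zero, neg_zero, Complex.exp_zero, mul_one, sub_zero] at hc
  linear_combination Complex.exp (a * z) * hc - u z * hexp z

theorem eq_mul_exp_of_hasDerivAt_mul {u : ℂ → ℂ} {a : ℂ}
    (hu : ∀ z, HasDerivAt u (a * u z) z) (z : ℂ) : u z = u 0 * Complex.exp (a * z) := by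
  simpa using eq_mul_exp_of_hasDerivAt (b := 0) (by simpa using hu) z

/-- If `g'' - (a + b) g' + a b g = 0` and every zero of `g` is multiple, then `g` solves
one of the two first order factors of the equation. -/
theorem hasDerivAt_mul_or_of_zeros_multiple {g g' : ℂ → ℂ} {a b : ℂ}
    (hg : ∀ z, HasDerivAt g (g' z) z)
    (hg' : ∀ z, HasDerivAt g' ((a + b) * g' z - a * b * g z) z)
    (hzero : ∀ z, g z = 0 → g' z = 0) :
    (∀ z, HasDerivAt g (a * g z) z) ∨ (∀ z, HasDerivAt g (b * g z) z) := by
  have ha := eq_mul_exp_of_hasDerivAt_mul (u := fun z => g' z - a * g z) (a := b)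
    (fun z => ((hg' z).sub ((hg z).const_mul a)).congr_deriv (by ring))
  have hb := eq_mul_exp_of_hasDerivAt_mul (u := fun z => g' z - b * g z) (a := a)
    (fun z => ((hg' z).sub ((hg z).const_mul b)).congr_deriv (by ring))
  set B := g' 0 - a * g 0
  set A := g' 0 - b * g 0
  by_cases hB : B = 0
  · left
    intro z
    refine (hg z).congr_deriv ?_
    have := ha z
    rw [hB] at this
    linear_combination this
  by_cases hA : A = 0
  · right
    intro z
    refine (hg z).congr_deriv ?_
    have := hb z
    rw [hA] at this
    linear_combination this
  exfalso
  obtain ⟨z, hz⟩ : ∃ z, g z = 0 := by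
    by_cases hab : a = b
    · subst hab
      have h := eq_mul_exp_of_hasDerivAt (u := g) (a := a) (b := B)
        (fun z => (hg z).congr_deriv (by linear_combination ha z))
      refine ⟨-g 0 / B, ?_⟩
      rw [h, mul_div_cancel₀ _ hB]
      simp
    · have hab' : a - b ≠ 0 := sub_ne_zero.mpr hab
      refine ⟨Complex.log (B / A) / (a - b), ?_⟩
      set z := Complex.log (B / A) / (a - b) with hz
      have hlog : Complex.exp (a * z) = B / A * Complex.exp (b * z) := by
        rw [← Complex.exp_log (div_ne_zero hB hA), ← Complex.exp_add]
        congr 1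
        rw [hz]
        field_simp
        ring
      have hAB : A * Complex.exp (a * z) = B * Complex.exp (b * z) := by
        rw [hlog]
        field_simp
      refine (mul_eq_zero.mp ?_).resolve_left hab'
      linear_combination hb z - ha z + hAB
  have h := ha z
  simp only [hz, hzero z hz, mul_zero, sub_zero] at h
  exact mul_ne_zero hB (Complex.exp_ne_zero _) h.symm

/-- If `f ^ n` has constant logarithmic derivative `a`, then `f` has constant logarithmic
derivative `a / n`. -/
theorem exists_eq_mul_exp_of_hasDerivAt_pow {f : ℂ → ℂ} (hf : Differentiable ℂ f)
    (hf0 : ∃ z, f z ≠ 0) {n : ℕ} (hn : n ≠ 0) {a : ℂ}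
    (h : ∀ z, HasDerivAt (fun x => f x ^ n) (a * f z ^ n) z) :
    ∃ C : ℂ, C ≠ 0 ∧ ∀ z, f z = C * Complex.exp (a / n * z) := by
  have hpow := eq_mul_exp_of_hasDerivAt_mul h
  obtain ⟨z₀, hz₀⟩ := hf0
  have h0 : f 0 ^ n ≠ 0 := by
    intro h0
    have := hpow z₀
    rw [h0, zero_mul] at this
    exact pow_ne_zero n hz₀ this
  have hne (z : ℂ) : f z ≠ 0 := by
    intro hz
    have := hpow z
    rw [hz, zero_pow hn] at this
    exact mul_ne_zero h0 (Complex.exp_ne_zero _) this.symm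
  refine ⟨f 0, hne 0, eq_mul_exp_of_hasDerivAt_mul fun z => ?_⟩
  refine (hf z).hasDerivAt.congr_deriv ?_
  have hu := ((hf z).hasDerivAt.pow n).unique (h z)
  have hn' : (n : ℂ) ≠ 0 := Nat.cast_ne_zero.mpr hn
  rw [← Nat.succ_pred_eq_of_ne_zero hn] at hu
  simp only [Nat.succ_eq_add_one, Nat.add_sub_cancel, pow_succ] at hu
  rw [Nat.pred_eq_sub_one, Nat.sub_add_cancel (Nat.one_le_iff_ne_zero.mpr hn)] at hu
  have hp := pow_ne_zero (n - 1) (hne z)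
  rw [div_mul_eq_mul_div, eq_div_iff hn']
  apply mul_left_cancel₀ hp
  linear_combination hu

theorem statement9 (n : ℕ) (hn : 2 ≤ n) (w α₁ : ℂ) (hw : w ≠ 0) (hα₁ : α₁ ≠ 0)
    (f : ℂ → ℂ) (hf : Differentiable ℂ f) (htrans : TranscendentalEntire f)
    (heq : ∀ z : ℂ,
      α₁ * f z ^ n + (α₁ * w - n) * f z ^ (n - 1) * deriv f z
        - ((n : ℂ) - 1) * w * f z ^ (n - 2) * (deriv f z) ^ 2
        - w * f z ^ (n - 1) * iteratedDeriv 2 f z = 0) :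
    ∃ C : ℂ, C ≠ 0 ∧
      ((∀ z : ℂ, f z = C * Complex.exp (-z / w)) ∨
       (∀ z : ℂ, f z = C * Complex.exp (α₁ * z / n))) := by
  have hn0 : n ≠ 0 := by omega
  have hn' : (n : ℂ) ≠ 0 := Nat.cast_ne_zero.mpr hn0
  have hf0 : ∃ z, f z ≠ 0 := by
    by_contra! h
    exact htrans ⟨0, by simpa using h⟩
  have hf' : Differentiable ℂ (deriv f) := hf.deriv
  have hg (z : ℂ) : HasDerivAt (fun x => f x ^ n) (n * f z ^ (n - 1) * deriv f z) z :=
    (hf z).hasDerivAt.pow n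
  have hg' (z : ℂ) : HasDerivAt (fun x => n * f x ^ (n - 1) * deriv f x)
      ((α₁ + -n / w) * (n * f z ^ (n - 1) * deriv f z) - α₁ * (-n / w) * f z ^ n) z := by
    refine ((((hf z).hasDerivAt.pow (n - 1)).const_mul (n : ℂ)).mul
      (hf' z).hasDerivAt).congr_deriv ?_
    have h := heq z
    rw [iteratedDeriv_succ, iteratedDeriv_one] at h
    rw [Nat.sub_sub, Nat.cast_sub (by omega : 1 ≤ n)]
    simp only [Pi.pow_apply, Nat.cast_one, Nat.reduceAdd]
    field_simp
    linear_combination -h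
  have hzero (z : ℂ) (hz : f z ^ n = 0) : n * f z ^ (n - 1) * deriv f z = 0 := by
    rw [pow_eq_zero_iff hn0] at hz
    rw [hz, zero_pow (by omega), mul_zero, zero_mul]
  rcases hasDerivAt_mul_or_of_zeros_multiple hg hg' hzero with h | h
  · obtain ⟨C, hC, hfC⟩ := exists_eq_mul_exp_of_hasDerivAt_pow hf hf0 hn0 h
    exact ⟨C, hC, .inr fun z => by rw [hfC, div_mul_eq_mul_div]⟩
  · obtain ⟨C, hC, hfC⟩ := exists_eq_mul_exp_of_hasDerivAt_pow hf hf0 hn0 h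
    refine ⟨C, hC, .inl fun z => ?_⟩
    rw [hfC]
    congr 2
    field_simp
end
end

section
/- Let n be a positive integer, c₁ ∈ ℂ, α ∈ ℂ, and d a nonzero complex number. Define g(z) = α + d/(e^{ndz + c₁} − 1) on the complement of the zero set of e^{ndz + c₁} − 1. Then every point z₀ with e^{ndz₀ + c₁} = 1 is a simple pole of g, and the residue of g at z₀ equals 1/n. Consequently, if n ≥ 2, there is no meromorphic function f on ℂ with f'/f = g, since the residue of f'/f at any zero of f is a positive integer. -/
open Filter

noncomputable section

open Topology in
/-- The logarithmic derivative of a meromorphic function has at most a simple pole,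
with an integer residue. -/
theorem exists_int_tendsto_sub_mul_logDeriv {f : ℂ → ℂ} {z₀ : ℂ}
    (hf : MeromorphicAt f z₀) :
    ∃ k : ℤ, Tendsto (fun z ↦ (z - z₀) * logDeriv f z) (𝓝[≠] z₀) (𝓝 (k : ℂ)) := by
  by_cases htop : meromorphicOrderAt f z₀ = ⊤
  · have hzero : f =ᶠ[𝓝[≠] z₀] fun _ ↦ (0 : ℂ) := meromorphicOrderAt_eq_top_iff.1 htop
    refine ⟨0, tendsto_const_nhds.congr' ?_⟩
    filter_upwards [logDeriv_congr_nhdsNE hzero] with z hz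
    simp [hz]
  · obtain ⟨h, hh, hne, hfh⟩ := (meromorphicOrderAt_ne_top_iff hf).1 htop
    generalize (meromorphicOrderAt f z₀).untop₀ = k at hfh
    refine ⟨k, ?_⟩
    have hlim : Tendsto (fun z ↦ (k : ℂ) + (z - z₀) * logDeriv h z) (𝓝[≠] z₀) (𝓝 (k : ℂ)) := by
      have hcont : ContinuousAt (fun z ↦ (k : ℂ) + (z - z₀) * (deriv h z / h z)) z₀ :=
        continuousAt_const.add ((continuousAt_id.sub continuousAt_const).mul
          (hh.deriv.continuousAt.div hh.continuousAt hne))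
      simpa [ContinuousAt, logDeriv_apply] using hcont.tendsto.mono_left nhdsWithin_le_nhds
    refine hlim.congr' ?_
    filter_upwards [logDeriv_congr_nhdsNE hfh, self_mem_nhdsWithin,
      hh.eventually_analyticAt.filter_mono nhdsWithin_le_nhds,
      (hh.continuousAt.eventually_ne hne).filter_mono nhdsWithin_le_nhds] with z hz hzz han hnz
    have hsub : z - z₀ ≠ 0 := sub_ne_zero.2 hzz
    have hdiff : DifferentiableAt ℂ (fun w ↦ w - z₀) z := by fun_prop
    have hdpow : DifferentiableAt ℂ (fun w ↦ (w - z₀) ^ k) z := hdiff.zpow (Or.inl hsub)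
    have hpow : logDeriv (fun w : ℂ ↦ (w - z₀) ^ k) z = k / (z - z₀) := by
      rw [logDeriv_fun_zpow hdiff, logDeriv_apply]
      simp [div_eq_mul_inv]
    rw [hz]
    simp only [smul_eq_mul]
    rw [logDeriv_mul (f := fun w ↦ (w - z₀) ^ k) z (zpow_ne_zero k hsub) hnz hdpow
      han.differentiableAt, hpow]
    field_simp

open Topology in
/-- At a simple zero of `F`, the function `α + d / F` has residue `d` divided by the derivative
of `F`. -/
theorem HasDerivAt.tendsto_sub_mul_const_add_div {F : ℂ → ℂ} {F' z₀ : ℂ}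
    (hF : HasDerivAt F F' z₀) (hF' : F' ≠ 0) (hz₀ : F z₀ = 0) (α d : ℂ) :
    Tendsto (fun z ↦ (z - z₀) * (α + d / F z)) (𝓝[≠] z₀) (𝓝 (d / F')) := by
  have hslope := (hasDerivAt_iff_tendsto_slope.1 hF).inv₀ hF'
  have hsub : Tendsto (fun z ↦ (z - z₀) * α) (𝓝[≠] z₀) (𝓝 0) := by
    have hcont : Continuous fun z : ℂ ↦ (z - z₀) * α := by fun_prop
    simpa using (hcont.tendsto z₀).mono_left nhdsWithin_le_nhds
  have hlim := hsub.add (hslope.const_mul d)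
  rw [zero_add, ← div_eq_mul_inv] at hlim
  refine hlim.congr fun z ↦ ?_
  simp only [slope_def_field, hz₀, sub_zero, inv_div]
  ring

theorem statement10 (n : ℕ) (hn : 1 ≤ n) (c₁ α d : ℂ) (hd : d ≠ 0)
    (g : ℂ → ℂ)
    (hg : ∀ z : ℂ, Complex.exp ((n : ℂ) * d * z + c₁) - 1 ≠ 0 →
      g z = α + d / (Complex.exp ((n : ℂ) * d * z + c₁) - 1)) :
    (∀ z₀ : ℂ, Complex.exp ((n : ℂ) * d * z₀ + c₁) = 1 →
      Filter.Tendsto (fun z : ℂ => (z - z₀) * g z) (nhdsWithin z₀ {z₀}ᶜ)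
        (nhds ((1 : ℂ) / n)) ∧ (1 : ℂ) / n ≠ 0) ∧
    (2 ≤ n →
      ¬ ∃ f : ℂ → ℂ, MeromorphicOn f Set.univ ∧
        ∀ z : ℂ, Complex.exp ((n : ℂ) * d * z + c₁) - 1 ≠ 0 →
          deriv f z / f z = g z) := by
  have hn₀ : (n : ℂ) ≠ 0 := Nat.cast_ne_zero.2 (by omega)
  have hderiv (z₀ : ℂ) (hz₀ : Complex.exp ((n : ℂ) * d * z₀ + c₁) = 1) :
      HasDerivAt (fun z : ℂ ↦ Complex.exp ((n : ℂ) * d * z + c₁) - 1) (n * d) z₀ := by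
    simpa [hz₀] using
      ((((hasDerivAt_id z₀).const_mul ((n : ℂ) * d)).add_const c₁).cexp).sub_const 1
  have hev (z₀ : ℂ) (hz₀ : Complex.exp ((n : ℂ) * d * z₀ + c₁) = 1) :
      ∀ᶠ z in nhdsWithin z₀ {z₀}ᶜ, Complex.exp ((n : ℂ) * d * z + c₁) - 1 ≠ 0 :=
    (hderiv z₀ hz₀).eventually_ne (mul_ne_zero hn₀ hd)
  have hres (z₀ : ℂ) (hz₀ : Complex.exp ((n : ℂ) * d * z₀ + c₁) = 1) :
      Tendsto (fun z : ℂ ↦ (z - z₀) * g z) (nhdsWithin z₀ {z₀}ᶜ) (nhds ((1 : ℂ) / n)) := by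
    have hlim := (hderiv z₀ hz₀).tendsto_sub_mul_const_add_div (mul_ne_zero hn₀ hd)
      (by simp [hz₀]) α d
    rw [show d / (n * d) = (1 : ℂ) / n by field_simp] at hlim
    refine hlim.congr' ?_
    filter_upwards [hev z₀ hz₀] with z hz
    rw [hg z hz]
  refine ⟨fun z₀ hz₀ ↦ ⟨hres z₀ hz₀, one_div_ne_zero hn₀⟩, ?_⟩
  rintro hn₂ ⟨f, hf, hfg⟩
  obtain ⟨z₀, hz₀⟩ : ∃ z₀ : ℂ, Complex.exp ((n : ℂ) * d * z₀ + c₁) = 1 := by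
    refine ⟨-c₁ / (n * d), ?_⟩
    rw [mul_div_cancel₀ _ (mul_ne_zero hn₀ hd), neg_add_cancel, Complex.exp_zero]
  obtain ⟨k, hk⟩ := exists_int_tendsto_sub_mul_logDeriv (hf z₀ (Set.mem_univ z₀))
  have hkn : (k : ℂ) = 1 / n := by
    refine tendsto_nhds_unique hk ((hres z₀ hz₀).congr' ?_)
    filter_upwards [hev z₀ hz₀] with z hz
    rw [logDeriv_apply, hfg z hz]
  have hmul : k * (n : ℤ) = 1 := by
    rw [eq_div_iff hn₀] at hkn
    exact_mod_cast hkn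
  have hle : (n : ℤ) ≤ 1 := Int.le_of_dvd one_pos (Dvd.intro_left k hmul)
  omega
end
end
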